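/- arXiv:1407.5268 — 2 statements merged into one kernel-verified Lean document; each statement's English description precedes it below -/
import Mathlib

section
/- If a signed graph G admits a nowhere-zero k-flow (an integer flow with all values in {±1, ±2, …, ±(k−1)}), then G has a signed circuit cover of total length at most 2(k−1)|E(G)|. -/
/-! ## Signed graphs, bidirected orientations, flows, circuits -/

/-- A signed graph on vertex type `V` and edge type `E`: each edge has two
half-edges (indexed by `Bool`), each with an endpoint, and a sign
(`true` = positive, `false` = negative). -/
structure SignedGraph (V E : Type) where
  ends : E → Bool → V
  sign : E → Bool

variable {V E : Type}

/-- A bidirected orientation: `dir e i = true` means the half-edge `i` of `e`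
is directed *toward* its endpoint.  Positive edges have one half in, one half
out; negative edges have both halves directed the same way. -/
structure SOrientation (G : SignedGraph V E) where
  dir : E → Bool → Bool
  compat : ∀ e, G.sign e = xor (dir e false) (dir e true)

/-- Reverse the orientation on the set of edges where `s e = true`. -/
def SOrientation.reorient {G : SignedGraph V E} (O : SOrientation G) (s : E → Bool) :
    SOrientation G where
  dir := fun e i => xor (s e) (O.dir e i)
  compat := by
    intro e
    have h := O.compat e
    cases hs : s e <;> simp [hs, h]

/-- Kirchhoff's law: at every vertex the sum of the values on incoming
half-edges equals the sum on outgoing half-edges. -/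
def IsFlow [Fintype E] [DecidableEq V] {G : SignedGraph V E} {A : Type} [AddCommGroup A]
    (O : SOrientation G) (f : E → A) : Prop :=
  ∀ v : V,
    (∑ e : E, ∑ i : Bool, if G.ends e i = v ∧ O.dir e i = true then f e else 0)
      = ∑ e : E, ∑ i : Bool, if G.ends e i = v ∧ O.dir e i = false then f e else 0

/-- `G` admits a nowhere-zero integer flow (is flow-admissible). -/
def HasNZFlow [Fintype E] [DecidableEq V] (G : SignedGraph V E) : Prop :=
  ∃ (O : SOrientation G) (φ : E → ℤ), IsFlow O φ ∧ ∀ e, φ e ≠ 0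

/-- `G` admits a nowhere-zero `k`-flow: an integer flow with values in
`{±1, …, ±(k-1)}`. -/
def HasNZkFlow [Fintype E] [DecidableEq V] (G : SignedGraph V E) (k : ℕ) : Prop :=
  ∃ (O : SOrientation G) (φ : E → ℤ), IsFlow O φ ∧ ∀ e, φ e ≠ 0 ∧ (φ e).natAbs ≤ k - 1

/-- A circuit of length `n+1` in `G`: pairwise distinct vertices
`vtx 0, …, vtx n` and pairwise distinct edges, where edge `i` joins `vtx i`
(via its half `half i`) to `vtx (i+1)` (via the other half); indices cyclic. -/
structure Circuit (G : SignedGraph V E) where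
  n : ℕ
  vtx : Fin (n + 1) → V
  edge : Fin (n + 1) → E
  half : Fin (n + 1) → Bool
  vtx_inj : Function.Injective vtx
  edge_inj : Function.Injective edge
  ends_src : ∀ i, G.ends (edge i) (half i) = vtx i
  ends_tgt : ∀ i, G.ends (edge i) (!(half i)) = vtx (i + 1)

/-- Number of edges of a circuit. -/
def Circuit.length {G : SignedGraph V E} (C : Circuit G) : ℕ := C.n + 1

/-- A circuit is balanced if it has an even number of negative edges. -/
def Circuit.Balanced {G : SignedGraph V E} (C : Circuit G) : Prop :=
  Even (Finset.univ.filter (fun i => G.sign (C.edge i) = false)).card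

/-- Consistency of a (raw) bidirection `d` at the vertex `vtx (i+1)` of a
circuit: exactly one of the two half-edges of the circuit at that vertex is
directed toward it. -/
def Circuit.ConsistentAt {G : SignedGraph V E} (C : Circuit G)
    (d : E → Bool → Bool) (i : Fin (C.n + 1)) : Prop :=
  d (C.edge i) (!(C.half i)) ≠ d (C.edge (i + 1)) (C.half (i + 1))

/-- A path of length `m` (possibly trivial, `m = 0`) in `G`. -/
structure GPath (G : SignedGraph V E) where
  m : ℕ
  vtx : Fin (m + 1) → V
  edge : Fin m → E
  half : Fin m → Bool
  vtx_inj : Function.Injective vtx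
  edge_inj : Function.Injective edge
  ends_src : ∀ i, G.ends (edge i) (half i) = vtx i.castSucc
  ends_tgt : ∀ i, G.ends (edge i) (!(half i)) = vtx i.succ

/-- A path is consistently directed (w.r.t. a raw bidirection `d`) if it is
consistent at every internal vertex. -/
def GPath.ConsDir {G : SignedGraph V E} (P : GPath G) (d : E → Bool → Bool) : Prop :=
  ∀ a b : Fin P.m, (a : ℕ) + 1 = (b : ℕ) →
    d (P.edge a) (!(P.half a)) ≠ d (P.edge b) (P.half b)

/-- A trail of length `m`: distinct edges, vertices may repeat. -/
structure Trail (G : SignedGraph V E) where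
  m : ℕ
  vtx : Fin (m + 1) → V
  edge : Fin m → E
  half : Fin m → Bool
  edge_inj : Function.Injective edge
  ends_src : ∀ i, G.ends (edge i) (half i) = vtx i.castSucc
  ends_tgt : ∀ i, G.ends (edge i) (!(half i)) = vtx i.succ

/-- A signed circuit: either a balanced circuit, or an unbalanced bicircuit,
i.e. two unbalanced circuits joined by a (possibly trivial) connecting path
which meets the circuits only at its ends; if the path is trivial the two
circuits share exactly one vertex, otherwise they are vertex-disjoint. -/
inductive SignedCircuit (G : SignedGraph V E) where
  | balanced (C : Circuit G) (hb : C.Balanced)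
  | bicircuit (C₁ C₂ : Circuit G) (P : GPath G)
      (h₁ : ¬ C₁.Balanced) (h₂ : ¬ C₂.Balanced)
      (hstart : P.vtx 0 ∈ Set.range C₁.vtx)
      (hend : P.vtx (Fin.last P.m) ∈ Set.range C₂.vtx)
      (hmeet : ∀ x, x ∈ Set.range C₁.vtx → x ∈ Set.range C₂.vtx →
        P.m = 0 ∧ x = P.vtx 0)
      (hpathint : ∀ k : Fin (P.m + 1), k ≠ 0 → k ≠ Fin.last P.m →
        P.vtx k ∉ Set.range C₁.vtx ∧ P.vtx k ∉ Set.range C₂.vtx)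
      (hedisj : ∀ a b, C₁.edge a ≠ C₂.edge b)
      (hpe₁ : ∀ a b, P.edge a ≠ C₁.edge b)
      (hpe₂ : ∀ a b, P.edge a ≠ C₂.edge b)

namespace SignedCircuit

variable {G : SignedGraph V E}

/-- The edge set of a signed circuit. -/
def edges : SignedCircuit G → Set E
  | balanced C _ => Set.range C.edge
  | bicircuit C₁ C₂ P _ _ _ _ _ _ _ _ _ =>
      Set.range C₁.edge ∪ Set.range C₂.edge ∪ Set.range P.edge

/-- The vertex set of a signed circuit. -/
def vertices : SignedCircuit G → Set V
  | balanced C _ => Set.range C.vtx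
  | bicircuit C₁ C₂ P _ _ _ _ _ _ _ _ _ =>
      Set.range C₁.vtx ∪ Set.range C₂.vtx ∪ Set.range P.vtx

/-- The number of edges (total length) of a signed circuit. -/
def length : SignedCircuit G → ℕ
  | balanced C _ => C.length
  | bicircuit C₁ C₂ P _ _ _ _ _ _ _ _ _ => C₁.length + C₂.length + P.m

/-- Whether a signed circuit is an unbalanced bicircuit. -/
def IsBicircuit : SignedCircuit G → Prop
  | balanced _ _ => False
  | bicircuit _ _ _ _ _ _ _ _ _ _ _ _ => True

/-- The length of the connecting path (`0` for a balanced circuit). -/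
def pathLength : SignedCircuit G → ℕ
  | balanced _ _ => 0
  | bicircuit _ _ P _ _ _ _ _ _ _ _ _ => P.m

open Classical in
/-- The characteristic flow of a signed circuit: `1` on a balanced circuit;
`1` on the connecting path and `1/2` on the two circuits of an unbalanced
bicircuit; `0` elsewhere. -/
noncomputable def chi : SignedCircuit G → E → ℚ
  | balanced C _ => fun e => if e ∈ Set.range C.edge then 1 else 0
  | bicircuit C₁ C₂ P _ _ _ _ _ _ _ _ _ => fun e =>
      if e ∈ Set.range P.edge then 1
      else if e ∈ Set.range C₁.edge ∪ Set.range C₂.edge then 1/2 else 0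

/-- A signed circuit is consistently directed w.r.t. the raw bidirection `d`
if every pair of adjacent edges in it is consistently directed, except at the
faulty vertices: a balanced circuit is consistent everywhere; in an unbalanced
bicircuit each constituent circuit fails to be consistent exactly at the
end-vertex of the connecting path lying on it, while the path itself, and the
junctions of the path (resp. of the other circuit, if the path is trivial)
with the circuits, are consistent. -/
def ConsistentlyDirected (d : E → Bool → Bool) : SignedCircuit G → Prop
  | balanced C _ => ∀ i, C.ConsistentAt d i
  | bicircuit C₁ C₂ P _ _ _ _ _ _ _ _ _ =>
      (∀ i, C₁.vtx (i + 1) ≠ P.vtx 0 → C₁.ConsistentAt d i) ∧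
      (∀ i, C₁.vtx (i + 1) = P.vtx 0 → ¬ C₁.ConsistentAt d i) ∧
      (∀ i, C₂.vtx (i + 1) ≠ P.vtx (Fin.last P.m) → C₂.ConsistentAt d i) ∧
      (∀ i, C₂.vtx (i + 1) = P.vtx (Fin.last P.m) → ¬ C₂.ConsistentAt d i) ∧
      P.ConsDir d ∧
      (∀ k : Fin P.m, (k : ℕ) = 0 → ∀ j, C₁.vtx (j + 1) = P.vtx 0 →
        d (P.edge k) (P.half k) ≠ d (C₁.edge j) (!(C₁.half j))) ∧
      (∀ k : Fin P.m, (k : ℕ) + 1 = P.m → ∀ j, C₂.vtx (j + 1) = P.vtx (Fin.last P.m) →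
        d (P.edge k) (!(P.half k)) ≠ d (C₂.edge j) (!(C₂.half j))) ∧
      (P.m = 0 → ∀ j₁ j₂, C₁.vtx (j₁ + 1) = P.vtx 0 → C₂.vtx (j₂ + 1) = P.vtx 0 →
        d (C₁.edge j₁) (!(C₁.half j₁)) ≠ d (C₂.edge j₂) (!(C₂.half j₂)))

end SignedCircuit

/-- Switching a signed graph at a vertex `v`: the signs of all non-loop edges
incident with `v` are negated (endpoints are unchanged). -/
def SignedGraph.switch [DecidableEq V] (G : SignedGraph V E) (v : V) : SignedGraph V E where
  ends := G.ends
  sign := fun e =>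
    if (G.ends e false = v ∨ G.ends e true = v) ∧ G.ends e false ≠ G.ends e true
    then !(G.sign e) else G.sign e

/-- A circuit of `G` is also a circuit of the switched graph. -/
def Circuit.ofSwitch [DecidableEq V] {G : SignedGraph V E} (v : V) (C : Circuit G) :
    Circuit (G.switch v) :=
  ⟨C.n, C.vtx, C.edge, C.half, C.vtx_inj, C.edge_inj, C.ends_src, C.ends_tgt⟩

namespace SCC

variable {G : SignedGraph V E}

/-- tail state of an arc (edge with leaving half) in the double cover -/
def tl (O : SOrientation G) (a : E × Bool) : V × Bool := (G.ends a.1 a.2, O.dir a.1 a.2)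

/-- head state of an arc -/
def hd (O : SOrientation G) (a : E × Bool) : V × Bool := (G.ends a.1 (!a.2), !(O.dir a.1 (!a.2)))

def rv (a : E × Bool) : E × Bool := (a.1, !a.2)

def fl (s : V × Bool) : V × Bool := (s.1, !s.2)

theorem fl_fl (s : V × Bool) : fl (fl s) = s := by simp [fl]

theorem fl_ne (s : V × Bool) : fl s ≠ s := by
  intro h
  have := congrArg Prod.snd h
  simp [fl] at this

theorem eq_fl {s t : V × Bool} (h1 : s.1 = t.1) (h2 : s ≠ t) : t = fl s := by
  obtain ⟨a, b⟩ := s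
  obtain ⟨c, d⟩ := t
  simp only at h1
  subst h1
  cases b <;> cases d <;> simp_all [fl]

theorem tl_rv (O : SOrientation G) (a : E × Bool) : tl O (rv a) = fl (hd O a) := by
  simp [tl, rv, fl, hd]

theorem hd_rv (O : SOrientation G) (a : E × Bool) : hd O (rv a) = fl (tl O a) := by
  simp [tl, rv, fl, hd]

theorem eq_or_rv {a b : E × Bool} (h : a.1 = b.1) : a = b ∨ a = rv b := by
  obtain ⟨a, x⟩ := a
  obtain ⟨b, y⟩ := b
  simp only at h
  subst h
  cases x <;> cases y <;> simp [rv]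

theorem sign_iff (O : SOrientation G) (a : E × Bool) :
    G.sign a.1 = false ↔ (tl O a).2 ≠ (hd O a).2 := by
  rw [O.compat a.1]
  obtain ⟨e, i⟩ := a
  cases i <;> cases h1 : O.dir e false <;> cases h2 : O.dir e true <;> simp [tl, hd, h1, h2]

def Walk (O : SOrientation G) : V × Bool → List (E × Bool) → V × Bool → Prop
  | s, [], t => s = t
  | s, a :: l, t => s = tl O a ∧ Walk O (hd O a) l t

theorem Walk.append {O : SOrientation G} {s t u : V × Bool} {l m : List (E × Bool)}
    (h1 : Walk O s l t) (h2 : Walk O t m u) : Walk O s (l ++ m) u := by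
  induction l generalizing s with
  | nil => simp only [Walk] at h1; subst h1; exact h2
  | cons a l ih => exact ⟨h1.1, ih h1.2⟩

theorem Walk.single (O : SOrientation G) (a : E × Bool) : Walk O (tl O a) [a] (hd O a) :=
  ⟨rfl, rfl⟩

theorem Walk.reverse {O : SOrientation G} {s t : V × Bool} {l : List (E × Bool)}
    (h : Walk O s l t) : Walk O (fl t) (l.map rv).reverse (fl s) := by
  induction l generalizing s with
  | nil => simp only [Walk] at h; subst h; rfl
  | cons a l ih =>
    obtain ⟨h1, h2⟩ := h
    subst h1
    rw [List.map_cons, List.reverse_cons]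
    refine (ih h2).append ?_
    rw [← tl_rv, ← hd_rv]
    exact Walk.single O _

theorem Walk.chain {O : SOrientation G} {s t : V × Bool} {l : List (E × Bool)}
    (h : Walk O s l t) : (∀ i, (hi : i + 1 < l.length) → hd O l[i] = tl O l[i+1]) ∧
      (∀ h0 : 0 < l.length, tl O l[0] = s ∧ hd O l[l.length - 1] = t) := by
  induction l generalizing s with
  | nil => simp
  | cons a l ih =>
    obtain ⟨h1, h2⟩ := h
    subst h1
    obtain ⟨c1, c2⟩ := ih h2
    constructor
    · intro i hi
      cases i with
      | zero =>
        simp only [List.length_cons] at hi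
        simpa using (c2 (by omega)).1.symm
      | succ i =>
        simp only [List.length_cons] at hi
        simpa using c1 i (by omega)
    · intro _
      refine ⟨rfl, ?_⟩
      cases l with
      | nil => simpa [Walk] using h2
      | cons b l => simpa using (c2 (by simp)).2

/-! ### Periodic sequences of arcs -/

theorem balanced_aux (O : SOrientation G) (a : ℕ → E × Bool)
    (hc : ∀ t, hd O (a t) = tl O (a (t+1))) (i m : ℕ) :
    Even (Finset.univ.filter (fun k : Fin m => G.sign (a (i + k)).1 = false)).card ↔
      (tl O (a i)).2 = (tl O (a (i + m))).2 := by
  induction m with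
  | zero => simp
  | succ m ih =>
    rw [Finset.card_filter] at ih ⊢
    rw [Fin.sum_univ_castSucc]
    simp only [Fin.val_castSucc, Fin.val_last]
    have h := sign_iff O (a (i+m))
    rw [hc] at h
    rw [← add_assoc]
    by_cases hs : G.sign (a (i+m)).1 = false
    · rw [if_pos hs, Nat.even_add_one, ih]
      have := h.1 hs
      generalize (tl O (a i)).2 = x at *
      generalize (tl O (a (i+m))).2 = y at *
      generalize (tl O (a (i+m+1))).2 = z at *
      revert this
      cases x <;> cases y <;> cases z <;> simp
    · rw [if_neg hs, add_zero, ih]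
      have : (tl O (a (i+m))).2 = (tl O (a (i+m+1))).2 := by
        by_contra hh
        exact hs (h.2 hh)
      rw [this]

theorem edge_ne (O : SOrientation G) (a : ℕ → E × Bool)
    (hc : ∀ t, hd O (a t) = tl O (a (t+1))) (i j : ℕ)
    (inj : ∀ p q, i ≤ p → p < q → q < j → (tl O (a p)).1 ≠ (tl O (a q)).1)
    (p q : ℕ) (hp : i ≤ p) (hpq : p < q) (hq : q < j) : (a p).1 ≠ (a q).1 := by
  intro h
  rcases eq_or_rv h with h | h
  · exact inj p q hp hpq hq (by rw [h])
  · have h1 : tl O (a (p+1)) = fl (tl O (a q)) := by rw [← hc, h, hd_rv]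
    by_cases hh : p + 1 = q
    · rw [hh] at h1
      exact fl_ne _ h1.symm
    · exact inj (p+1) q (by omega) (by omega) hq (by rw [h1]; rfl)

def mkC (O : SOrientation G) (a : ℕ → E × Bool)
    (hc : ∀ t, hd O (a t) = tl O (a (t+1))) (i m : ℕ)
    (hcl : (tl O (a (i + m + 1))).1 = (tl O (a i)).1)
    (inj : ∀ p q, i ≤ p → p < q → q < i + m + 1 → (tl O (a p)).1 ≠ (tl O (a q)).1) :
    Circuit G where
  n := m
  vtx k := (tl O (a (i + k))).1
  edge k := (a (i + k)).1
  half k := (a (i + k)).2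
  vtx_inj := by
    intro x y h
    rcases lt_trichotomy x.val y.val with h1 | h1 | h1
    · exact absurd h (inj _ _ (by omega) (by omega) (by omega))
    · exact Fin.ext h1
    · exact absurd h.symm (inj _ _ (by omega) (by omega) (by omega))
  edge_inj := by
    intro x y h
    rcases lt_trichotomy x.val y.val with h1 | h1 | h1
    · exact absurd h (edge_ne O a hc i (i+m+1) inj _ _ (by omega) (by omega) (by omega))
    · exact Fin.ext h1
    · exact absurd h.symm (edge_ne O a hc i (i+m+1) inj _ _ (by omega) (by omega) (by omega))
  ends_src k := rfl
  ends_tgt k := by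
    have h : G.ends (a (i + k)).1 (!(a (i+k)).2) = (tl O (a (i + k + 1))).1 := by
      rw [← hc]; rfl
    rw [h]
    induction k using Fin.lastCases with
    | last => simp [hcl]
    | cast k => simp [add_assoc]

theorem mkC_vtx (O : SOrientation G) (a : ℕ → E × Bool)
    (hc : ∀ t, hd O (a t) = tl O (a (t+1))) (i m : ℕ) (hcl) (inj) (x : V) :
    x ∈ Set.range (mkC O a hc i m hcl inj).vtx ↔
      ∃ t, i ≤ t ∧ t < i + m + 1 ∧ (tl O (a t)).1 = x := by
  constructor
  · rintro ⟨k, rfl⟩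
    exact ⟨i + k.val, by omega, by have : k.val < m + 1 := k.isLt; omega, rfl⟩
  · rintro ⟨t, h1, h2, rfl⟩
    refine ⟨(⟨t - i, by omega⟩ : Fin (m+1)), ?_⟩
    change (tl O (a (i + (t - i)))).1 = _
    rw [Nat.add_sub_cancel' h1]

theorem mkC_edge (O : SOrientation G) (a : ℕ → E × Bool)
    (hc : ∀ t, hd O (a t) = tl O (a (t+1))) (i m : ℕ) (hcl) (inj) (x : E) :
    x ∈ Set.range (mkC O a hc i m hcl inj).edge ↔
      ∃ t, i ≤ t ∧ t < i + m + 1 ∧ (a t).1 = x := by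
  constructor
  · rintro ⟨k, rfl⟩
    exact ⟨i + k.val, by omega, by have : k.val < m + 1 := k.isLt; omega, rfl⟩
  · rintro ⟨t, h1, h2, rfl⟩
    refine ⟨(⟨t - i, by omega⟩ : Fin (m+1)), ?_⟩
    change (a (i + (t - i))).1 = _
    rw [Nat.add_sub_cancel' h1]

theorem mkC_bal (O : SOrientation G) (a : ℕ → E × Bool)
    (hc : ∀ t, hd O (a t) = tl O (a (t+1))) (i m : ℕ) (hcl) (inj) :
    (mkC O a hc i m hcl inj).Balanced ↔ (tl O (a i)).2 = (tl O (a (i + m + 1))).2 := by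
  exact balanced_aux O a hc i (m+1)

def mkP (O : SOrientation G) (a : ℕ → E × Bool)
    (hc : ∀ t, hd O (a t) = tl O (a (t+1))) (i m : ℕ)
    (inj : ∀ p q, i ≤ p → p < q → q < i + m + 1 → (tl O (a p)).1 ≠ (tl O (a q)).1) :
    GPath G where
  m := m
  vtx k := (tl O (a (i + k))).1
  edge k := (a (i + k)).1
  half k := (a (i + k)).2
  vtx_inj := by
    intro x y h
    rcases lt_trichotomy x.val y.val with h1 | h1 | h1
    · exact absurd h (inj _ _ (by omega) (by omega) (by omega))
    · exact Fin.ext h1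
    · exact absurd h.symm (inj _ _ (by omega) (by omega) (by omega))
  edge_inj := by
    intro x y h
    rcases lt_trichotomy x.val y.val with h1 | h1 | h1
    · exact absurd h (edge_ne O a hc i (i+m+1) inj _ _ (by omega) (by omega) (by omega))
    · exact Fin.ext h1
    · exact absurd h.symm (edge_ne O a hc i (i+m+1) inj _ _ (by omega) (by omega) (by omega))
  ends_src k := rfl
  ends_tgt k := by
    have h : G.ends (a (i + k)).1 (!(a (i+k)).2) = (tl O (a (i + k + 1))).1 := by
      rw [← hc]; rfl
    rw [h]
    simp [add_assoc]

/-- endpoints of equal edges -/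
theorem ends_of_eq (O : SOrientation G) (a : ℕ → E × Bool)
    (hc : ∀ t, hd O (a t) = tl O (a (t+1))) (p q : ℕ) (h : (a p).1 = (a q).1) :
    (tl O (a p) = tl O (a q) ∧ tl O (a (p+1)) = tl O (a (q+1))) ∨
    (tl O (a p) = fl (tl O (a (q+1))) ∧ tl O (a (p+1)) = fl (tl O (a q))) := by
  rcases eq_or_rv h with h | h
  · left
    rw [← hc, ← hc, h]; simp
  · right
    rw [← hc, ← hc, h, tl_rv, hd_rv]; simp

/-- The bicircuit formed by two consecutive closed arcs. -/
theorem exists_bicircuit (O : SOrientation G) (a : ℕ → E × Bool)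
    (hc : ∀ t, hd O (a t) = tl O (a (t+1))) (i j i' j' : ℕ)
    (hij : i < j) (hji : j ≤ i') (hij' : i' < j')
    (hv : (tl O (a i)).1 = (tl O (a j)).1) (hs : tl O (a i) ≠ tl O (a j))
    (hv' : (tl O (a i')).1 = (tl O (a j')).1) (hs' : tl O (a i') ≠ tl O (a j'))
    (inj : ∀ p q, i < p → p < q → q < j' → (tl O (a p)).1 ≠ (tl O (a q)).1) :
    ∃ C : SignedCircuit G, (∀ t, i ≤ t → t < j' → (a t).1 ∈ C.edges) ∧ C.length = j' - i := by
  obtain ⟨m, rfl⟩ : ∃ m, j = i + m + 1 := ⟨j - i - 1, by omega⟩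
  obtain ⟨r, rfl⟩ : ∃ r, i' = i + m + 1 + r := ⟨i' - (i + m + 1), by omega⟩
  obtain ⟨m', rfl⟩ : ∃ m', j' = i + m + 1 + r + m' + 1 := ⟨j' - (i + m + 1 + r) - 1, by omega⟩
  have inj' : ∀ p q, i < p → p < i + m + 1 + r + m' + 1 → i < q → q < i + m + 1 + r + m' + 1 →
      (tl O (a p)).1 = (tl O (a q)).1 → p = q := by
    intro p q h1 h2 h3 h4 h5
    rcases lt_trichotomy p q with h | h | h
    · exact absurd h5 (inj p q h1 h h4)
    · exact h
    · exact absurd h5.symm (inj q p h3 h h2)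
  have injC : ∀ p q, i ≤ p → p < q → q < i + m + 1 → (tl O (a p)).1 ≠ (tl O (a q)).1 := by
    intro p q h1 h2 h3 h4
    by_cases h : p = i
    · subst h
      rw [hv] at h4
      have := inj' _ _ (by omega) (by omega) (by omega) (by omega) h4
      omega
    · exact inj p q (by omega) h2 (by omega) h4
  have bal : ∀ {s t : V × Bool}, s.1 = t.1 → s ≠ t → ¬ s.2 = t.2 :=
    fun h1 h2 h3 => h2 (Prod.ext h1 h3)
  -- membership in the vertex set of the first circuit
  have mem1 : ∀ t, i ≤ t → t < i + m + 1 →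
      ∃ p, i < p ∧ p ≤ i + m + 1 ∧ (tl O (a p)).1 = (tl O (a t)).1 := by
    intro t h1 h2
    by_cases h : t = i
    · subst h
      exact ⟨_, by omega, le_refl _, hv.symm⟩
    · exact ⟨t, by omega, by omega, rfl⟩
  have mem2 : ∀ t, i + m + 1 + r ≤ t → t ≤ i + m + 1 + r + m' + 1 →
      ∃ p, i + m + 1 + r ≤ p ∧ p < i + m + 1 + r + m' + 1 ∧ (tl O (a p)).1 = (tl O (a t)).1 := by
    intro t h1 h2
    by_cases h : t = i + m + 1 + r + m' + 1
    · subst h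
      exact ⟨_, le_refl _, by omega, hv'⟩
    · exact ⟨t, by omega, by omega, rfl⟩
  have mem1' : ∀ t, i ≤ t → t ≤ i + m + 1 →
      ∃ p, i < p ∧ p ≤ i + m + 1 ∧ (tl O (a p)).1 = (tl O (a t)).1 := by
    intro t h1 h2
    by_cases h : t = i + m + 1
    · exact ⟨t, by omega, by omega, rfl⟩
    · exact mem1 t h1 (by omega)
  let C1 := mkC O a hc i m hv.symm injC
  let C2 := mkC O a hc (i + m + 1 + r) m' hv'.symm
    (fun p q h1 h2 h3 => inj p q (by omega) h2 (by omega))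
  let P := mkP O a hc (i + m + 1) r (fun p q h1 h2 h3 => inj p q (by omega) h2 (by omega))
  have key12 : ∀ p q, i ≤ p → p < i + m + 1 → i + m + 1 + r ≤ q → q < i + m + 1 + r + m' + 1 →
      (a p).1 ≠ (a q).1 := by
    intro p q h1 h2 h3 h4 h
    -- common vertices force everything to be the junction
    have common : ∀ x y, i ≤ x → x ≤ i + m + 1 → i + m + 1 + r ≤ y →
        y ≤ i + m + 1 + r + m' + 1 → (tl O (a x)).1 = (tl O (a y)).1 →
        r = 0 ∧ (tl O (a x)).1 = (tl O (a (i + m + 1))).1 ∧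
          (tl O (a y)).1 = (tl O (a (i + m + 1 + r))).1 := by
      intro x y x1 x2 y1 y2 hxy
      obtain ⟨p', p1, p2, p3⟩ := mem1' x x1 x2
      obtain ⟨q', q1, q2, q3⟩ := mem2 y y1 y2
      have := inj' p' q' (by omega) (by omega) (by omega) (by omega) (by rw [p3, q3, hxy])
      have e1 : p' = i + m + 1 := by omega
      have e2 : q' = i + m + 1 + r := by omega
      rw [← p3, ← q3, e1, e2]
      exact ⟨by omega, rfl, rfl⟩
    have loop : r = 0 ∧ m = 0 ∧ m' = 0 := by
      have main : r = 0 ∧ (tl O (a p)).1 = (tl O (a (p+1))).1 ∧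
          (tl O (a q)).1 = (tl O (a (q+1))).1 := by
        rcases ends_of_eq O a hc p q h with ⟨ha, hb⟩ | ⟨ha, hb⟩
        · have c1 := common p q h1 (by omega) h3 (by omega) (by rw [ha])
          have c2 := common (p+1) (q+1) (by omega) (by omega) (by omega) (by omega) (by rw [hb])
          exact ⟨c1.1, by rw [c1.2.1, c2.2.1], by rw [c1.2.2, c2.2.2]⟩
        · have c1 := common p (q+1) h1 (by omega) (by omega) (by omega) (by rw [ha]; rfl)
          have c2 := common (p+1) q (by omega) (by omega) (by omega) (by omega) (by rw [hb]; rfl)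
          exact ⟨c1.1, by rw [c1.2.1, c2.2.1], by rw [c1.2.2, c2.2.2]⟩
      obtain ⟨r0, e1, e2⟩ := main
      refine ⟨r0, ?_, ?_⟩
      · by_cases hp : p = i
        · subst hp
          rw [hv] at e1
          have := inj' _ _ (by omega) (by omega) (by omega) (by omega) e1
          omega
        · have := inj' _ _ (by omega) (by omega) (by omega) (by omega) e1
          omega
      · by_cases hq : q + 1 = i + m + 1 + r + m' + 1
        · rw [hq, ← hv'] at e2
          have := inj' _ _ (by omega) (by omega) (by omega) (by omega) e2
          omega
        · have := inj' _ _ (by omega) (by omega) (by omega) (by omega) e2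
          omega
    obtain ⟨r0, m0, m0'⟩ := loop
    have hp : p = i := by omega
    have hq : q = i + 1 := by omega
    subst r0 m0 m0' hp hq
    rcases ends_of_eq O a hc _ _ h with ⟨ha, hb⟩ | ⟨ha, hb⟩
    · exact hs ha
    · exact fl_ne _ hb.symm
  refine ⟨.bicircuit C1 C2 P ?_ ?_ ?_ ?_ ?_ ?_ ?_ ?_ ?_, ?_, ?_⟩
  · rw [mkC_bal]; exact bal hv hs
  · rw [mkC_bal]; exact bal hv' hs'
  · rw [mkC_vtx]
    exact ⟨i, le_refl _, by omega, hv⟩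
  · rw [mkC_vtx]
    exact ⟨i + m + 1 + r, le_refl _, by omega, rfl⟩
  · intro x
    rw [mkC_vtx, mkC_vtx]
    rintro ⟨t, t1, t2, rfl⟩ ⟨u, u1, u2, hu⟩
    obtain ⟨p, p1, p2, p3⟩ := mem1 t t1 t2
    have := inj' p u (by omega) (by omega) (by omega) (by omega) (by rw [p3, hu])
    have e1 : p = i + m + 1 := by omega
    refine ⟨show r = 0 by omega, ?_⟩
    rw [← p3, e1]
    rfl
  · intro k h0 hl
    have k1 : k.val ≠ 0 := fun h => h0 (Fin.ext h)
    have k2 : k.val ≠ r := fun h => hl (Fin.ext h)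
    have k3 : k.val < r + 1 := k.isLt
    rw [mkC_vtx, mkC_vtx]
    constructor
    · rintro ⟨t, t1, t2, ht⟩
      obtain ⟨p, p1, p2, p3⟩ := mem1 t t1 t2
      have := inj' p (i + m + 1 + k.val) (by omega) (by omega) (by omega) (by omega)
        (by rw [p3, ht]; rfl)
      omega
    · rintro ⟨t, t1, t2, ht⟩
      have := inj' t (i + m + 1 + k.val) (by omega) (by omega) (by omega) (by omega)
        (by rw [ht]; rfl)
      omega
  · intro x y
    have hx : x.val < m + 1 := x.isLt
    have hy : y.val < m' + 1 := y.isLt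
    exact key12 _ _ (by omega) (by omega) (by omega) (by omega)
  · intro x y h
    have hx : x.val < r := x.isLt
    have hy : y.val < m + 1 := y.isLt
    have : ∃ t, i ≤ t ∧ t ≤ i + m + 1 ∧ (tl O (a t)).1 = (tl O (a (i + m + 1 + x.val + 1))).1 := by
      rcases ends_of_eq O a hc (i + m + 1 + x.val) (i + y.val) h with ⟨ha, hb⟩ | ⟨ha, hb⟩
      · exact ⟨i + y.val + 1, by omega, by omega, by rw [hb]⟩
      · exact ⟨i + y.val, by omega, by omega, by rw [hb]; rfl⟩
    obtain ⟨t, t1, t2, ht⟩ := this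
    obtain ⟨p, p1, p2, p3⟩ := mem1' t t1 t2
    have := inj' p _ (by omega) (by omega) (by omega) (by omega) (p3.trans ht)
    omega
  · intro x y h
    have hx : x.val < r := x.isLt
    have hy : y.val < m' + 1 := y.isLt
    have : ∃ t, i + m + 1 + r ≤ t ∧ t ≤ i + m + 1 + r + m' + 1 ∧
        (tl O (a t)).1 = (tl O (a (i + m + 1 + x.val))).1 := by
      rcases ends_of_eq O a hc (i + m + 1 + x.val) (i + m + 1 + r + y.val) h with ⟨ha, hb⟩ | ⟨ha, hb⟩
      · exact ⟨i + m + 1 + r + y.val, by omega, by omega, by rw [ha]⟩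
      · exact ⟨i + m + 1 + r + y.val + 1, by omega, by omega, by rw [ha]; rfl⟩
    obtain ⟨t, t1, t2, ht⟩ := this
    obtain ⟨p, p1, p2, p3⟩ := mem2 t t1 t2
    have := inj' p _ (by omega) (by omega) (by omega) (by omega) (p3.trans ht)
    omega
  · intro t t1 t2
    by_cases h1 : t < i + m + 1
    · left; left
      rw [mkC_edge]
      exact ⟨t, t1, h1, rfl⟩
    · by_cases h2 : t < i + m + 1 + r
      · right
        refine ⟨(⟨t - (i + m + 1), by omega⟩ : Fin r), ?_⟩
        change (a (i + m + 1 + (t - (i + m + 1)))).1 = _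
        rw [Nat.add_sub_cancel' (by omega)]
      · left; right
        rw [mkC_edge]
        exact ⟨t, by omega, t2, rfl⟩
  · change (m + 1) + (m' + 1) + r = _
    omega

/-- The chain of bicircuits in an irreducible closed walk. -/
theorem chain_cover (O : SOrientation G) (a : ℕ → E × Bool)
    (hc : ∀ t, hd O (a t) = tl O (a (t+1))) (n d : ℕ) (hper : ∀ t, a (t + n) = a t)
    (hd0 : 0 < d) (hdn : d < n)
    (hdv : (tl O (a 0)).1 = (tl O (a d)).1)
    (hmin : ∀ p q, p < q → q < p + d → (tl O (a p)).1 ≠ (tl O (a q)).1)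
    (hA : ∀ i j, i < j → j < i + n → tl O (a i) ≠ tl O (a j))
    (hB : ∀ i i' j j', i < i' → i' < j → j < j' → j' ≤ i + n →
      (tl O (a i)).1 = (tl O (a j)).1 → (tl O (a i')).1 ≠ (tl O (a j')).1)
    (N : ℕ) : ∀ i j, n - j ≤ N → i < j → j < i + n → d ≤ j → j ≤ n →
      (tl O (a i)).1 = (tl O (a j)).1 →
      (∀ p q, i < p → p < q → q ≤ j → (tl O (a p)).1 ≠ (tl O (a q)).1) →
      ∃ L : List (SignedCircuit G), (∀ t, i ≤ t → t < n + d → ∃ C ∈ L, (a t).1 ∈ C.edges) ∧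
        (L.map SignedCircuit.length).sum + (j - i) + d ≤ 2 * (n + d - i) := by
  classical
  induction N with
  | zero => ?_
  | succ N ih => ?_
  all_goals
    intro i j hN hij hjn hdj hjle hv inj
    have hnd : (tl O (a n)).1 = (tl O (a (n + d))).1 := by
      rw [Nat.add_comm n d, hper, ← hdv]
      have := hper 0
      rw [Nat.zero_add] at this
      rw [this]
    have hex : ∃ x, j < x ∧ ∃ y, i < y ∧ y < x ∧ (tl O (a y)).1 = (tl O (a x)).1 :=
      ⟨n + d, by omega, n, by omega, by omega, hnd⟩
    obtain ⟨j', hj'⟩ : ∃ x, x = Nat.find hex := ⟨_, rfl⟩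
    have hQ := Nat.find_spec hex
    have hQm : ∀ x, x < j' → ¬ _ := fun x hx => Nat.find_min hex (hj' ▸ hx)
    rw [← hj'] at hQ
    obtain ⟨hjj, i', hi1, hi2, hv'⟩ := hQ
    have hle : j' ≤ n + d := by
      by_contra hh
      exact hQm (n + d) (by omega) ⟨by omega, n, by omega, by omega, hnd⟩
    have inj2 : ∀ p q, i < p → p < q → q < j' → (tl O (a p)).1 ≠ (tl O (a q)).1 := by
      intro p q h1 h2 h3 h4
      by_cases hq : q ≤ j
      · exact inj p q h1 h2 hq h4
      · exact hQm q h3 ⟨by omega, p, h1, h2, h4⟩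
    have hji : j ≤ i' := by
      by_contra hh
      refine hB i i' j j' hi1 (by omega) hjj ?_ hv hv'
      by_contra h2
      refine inj2 j (i + n) (by omega) hjn (by omega) ?_
      rw [hper, hv]
    have hend : j' = n + d → i' = n := by
      intro h
      subst h
      rw [← hnd] at hv'
      rcases lt_trichotomy i' n with h | h | h
      · exact absurd hv' (inj2 _ _ hi1 h (by omega))
      · exact h
      · exact absurd hv'.symm (inj2 _ _ (by omega) h hi2)
    have hlen : j' < i' + n := by
      by_cases h : j' = n + d
      · have := hend h
        omega
      · omega
    obtain ⟨C, hC1, hC2⟩ := exists_bicircuit O a hc i j i' j' hij hji hi2 hv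
      (hA _ _ hij hjn) hv' (hA _ _ hi2 hlen) inj2
    by_cases hfin : j' = n + d
    · refine ⟨[C], ?_, ?_⟩
      · intro t t1 t2
        exact ⟨C, by simp, hC1 t t1 (by omega)⟩
      · simp only [List.map_cons, List.map_nil, List.sum_cons, List.sum_nil, hC2]
        omega
    have hj'n : j' ≤ n := by
      by_contra hh
      by_cases h : i' < n
      · exact hB i' n j' (n + d) h (by omega) (by omega) (by omega) hv' hnd
      · exact hmin i' j' hi2 (by omega) hv'
  · omega
  · obtain ⟨L, hL1, hL2⟩ := ih i' j' (by omega) hi2 hlen (by omega) hj'n hv'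
      (by
        intro p q h1 h2 h3 h4
        by_cases hq : q < j'
        · exact inj2 p q (by omega) h2 hq h4
        · have : q = j' := by omega
          subst this
          rw [← hv'] at h4
          exact inj2 i' p hi1 h1 h2 h4.symm)
    refine ⟨C :: L, ?_, ?_⟩
    · intro t t1 t2
      by_cases h : t < j'
      · exact ⟨C, by simp, hC1 t t1 h⟩
      · obtain ⟨D, hD, hD2⟩ := hL1 t (by omega) t2
        exact ⟨D, by simp [hD], hD2⟩
    · simp only [List.map_cons, List.sum_cons, hC2]
      omega

def seg (a : ℕ → E × Bool) (i m : ℕ) : List (E × Bool) := (List.range m).map (fun k => a (i + k))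

theorem seg_walk (O : SOrientation G) (a : ℕ → E × Bool)
    (hc : ∀ t, hd O (a t) = tl O (a (t+1))) (i m : ℕ) :
    Walk O (tl O (a i)) (seg a i m) (tl O (a (i + m))) := by
  induction m with
  | zero => simp [seg, Walk]
  | succ m ih =>
    have : seg a i (m+1) = seg a i m ++ [a (i + m)] := by simp [seg, List.range_succ]
    rw [this, ← add_assoc, ← hc]
    exact ih.append (Walk.single O _)

theorem mem_seg (a : ℕ → E × Bool) (i m t : ℕ) (h1 : i ≤ t) (h2 : t < i + m) :
    a t ∈ seg a i m := by
  simp only [seg, List.mem_map, List.mem_range]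
  exact ⟨t - i, by omega, by rw [Nat.add_sub_cancel' h1]⟩

theorem seg_length (a : ℕ → E × Bool) (i m : ℕ) : (seg a i m).length = m := by simp [seg]

/-- Closed consistent walks have short signed circuit covers. -/
theorem closed_cover (O : SOrientation G) (n : ℕ) : ∀ (s : V × Bool) (l : List (E × Bool)),
    l.length = n → Walk O s l s →
    ∃ L : List (SignedCircuit G), (∀ b ∈ l, ∃ C ∈ L, b.1 ∈ C.edges) ∧
      (L.map SignedCircuit.length).sum ≤ 2 * n := by
  classical
  induction n using Nat.strong_induction_on with
  | _ n ih => ?_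
  intro s l hl hw
  rcases Nat.eq_zero_or_pos n with h0 | hn
  · have : l = [] := List.length_eq_zero_iff.1 (hl.trans h0)
    subst this
    exact ⟨[], by simp, by simp⟩
  -- the periodic sequence
  have hmod : ∀ t, t % n < l.length := fun t => by rw [hl]; exact Nat.mod_lt _ hn
  obtain ⟨a, hper, hc, hcov⟩ : ∃ a : ℕ → E × Bool, (∀ t, a (t + n) = a t) ∧
      (∀ t, hd O (a t) = tl O (a (t+1))) ∧ (∀ b ∈ l, ∃ t, a t = b) := by
    refine ⟨fun t => l[t % n]'(hmod t), ?_, ?_, ?_⟩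
    · intro t; simp
    · intro t
      obtain ⟨c1, c2⟩ := hw.chain
      have hlt := Nat.mod_lt t hn
      by_cases h : t % n + 1 < n
      · have e : (t + 1) % n = t % n + 1 := by
          rw [Nat.add_mod, Nat.mod_eq_of_lt (a := 1) (by omega), Nat.mod_eq_of_lt h]
        simp only [e]
        exact c1 _ (by omega)
      · have e1 : t % n = l.length - 1 := by omega
        have e : (t + 1) % n = 0 := by
          rw [Nat.add_mod_eq_add_mod_right 1 (show t % n = (n - 1) % n by rw [Nat.mod_eq_of_lt (a := n - 1) (by omega)]; omega)]
          rw [Nat.sub_add_cancel hn, Nat.mod_self]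
        simp only [e, e1]
        rw [(c2 (by omega)).1, (c2 (by omega)).2]
    · intro b hb
      obtain ⟨i, hi, rfl⟩ := List.getElem_of_mem hb
      refine ⟨i, ?_⟩
      simp only [Nat.mod_eq_of_lt (show i < n by omega)]
  have hperm : ∀ t k, a (t + k * n) = a t := by
    intro t k
    induction k with
    | zero => simp
    | succ k ihk => rw [Nat.succ_mul, ← add_assoc, hper, ihk]
  -- every arc occurs in every window
  have window : ∀ i, ∀ b ∈ l, ∃ t, i ≤ t ∧ t < i + n ∧ a t = b := by
    intro i
    induction i with
    | zero =>
      intro b hb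
      obtain ⟨t, ht⟩ := hcov b hb
      refine ⟨t % n, by omega, by rw [Nat.zero_add]; exact Nat.mod_lt _ hn, ?_⟩
      rw [← ht, ← hperm (t % n) (t / n), Nat.mul_comm, Nat.mod_add_div]
    | succ i ihi =>
      intro b hb
      obtain ⟨t, t1, t2, t3⟩ := ihi b hb
      by_cases h : t = i
      · exact ⟨t + n, by omega, by omega, by rw [hper, t3]⟩
      · exact ⟨t, by omega, by omega, t3⟩
  -- combining two shorter closed walks
  have combine : ∀ (s1 s2 : V × Bool) (l1 l2 : List (E × Bool)), Walk O s1 l1 s1 →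
      Walk O s2 l2 s2 → l1.length + l2.length = n → l1.length < n → l2.length < n →
      (∀ b ∈ l, (∃ c ∈ l1, c.1 = b.1) ∨ (∃ c ∈ l2, c.1 = b.1)) →
      ∃ L : List (SignedCircuit G), (∀ b ∈ l, ∃ C ∈ L, b.1 ∈ C.edges) ∧
      (L.map SignedCircuit.length).sum ≤ 2 * n := by
    intro s1 s2 l1 l2 w1 w2 hlen h1 h2 hcv
    obtain ⟨L1, a1, b1⟩ := ih _ h1 s1 l1 rfl w1
    obtain ⟨L2, a2, b2⟩ := ih _ h2 s2 l2 rfl w2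
    refine ⟨L1 ++ L2, ?_, ?_⟩
    · intro b hb
      rcases hcv b hb with ⟨c, c1, c2⟩ | ⟨c, c1, c2⟩
      · obtain ⟨C, hC, hC2⟩ := a1 c c1
        exact ⟨C, by simp [hC], c2 ▸ hC2⟩
      · obtain ⟨C, hC, hC2⟩ := a2 c c1
        exact ⟨C, by simp [hC], c2 ▸ hC2⟩
    · rw [List.map_append, List.sum_append]
      omega
  by_cases hA : ∀ i j, i < j → j < i + n → tl O (a i) ≠ tl O (a j)
  swap
  · push Not at hA
    obtain ⟨i, j, hij, hjn, hs⟩ := hA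
    have w1 := seg_walk O a hc i (j - i)
    have w2 := seg_walk O a hc j (i + n - j)
    rw [Nat.add_sub_cancel' (by omega)] at w1 w2
    rw [hper, hs] at w2
    rw [hs] at w1
    refine combine _ _ _ _ w1 w2 ?_ ?_ ?_ ?_
    · rw [seg_length, seg_length]; omega
    · rw [seg_length]; omega
    · rw [seg_length]; omega
    · intro b hb
      obtain ⟨t, t1, t2, rfl⟩ := window i b hb
      by_cases h : t < j
      · exact Or.inl ⟨a t, mem_seg a _ _ _ t1 (by omega), rfl⟩
      · exact Or.inr ⟨a t, mem_seg a _ _ _ (by omega) (by omega), rfl⟩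
  by_cases hB : ∀ i i' j j', i < i' → i' < j → j < j' → j' ≤ i + n →
      (tl O (a i)).1 = (tl O (a j)).1 → (tl O (a i')).1 ≠ (tl O (a j')).1
  swap
  · push Not at hB
    obtain ⟨i, i', j, j', h1, h2, h3, h4, e1, e2⟩ := hB
    have f1 := eq_fl e1 (hA i j (by omega) (by omega))
    have f2 := eq_fl e2 (hA i' j' (by omega) (by omega))
    have wA := seg_walk O a hc i (i' - i)
    have wB := seg_walk O a hc i' (j - i')
    have wC := (seg_walk O a hc j (j' - j)).reverse
    have wD := (seg_walk O a hc j' (i + n - j')).reverse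
    rw [Nat.add_sub_cancel' (by omega)] at wA wB wC wD
    rw [f1, f2, fl_fl, fl_fl] at wC
    rw [hper, f2, fl_fl, ← f1] at wD
    have rvmem : ∀ x m t, x ≤ t → t < x + m →
        ∃ c ∈ ((seg a x m).map rv).reverse, c.1 = (a t).1 := by
      intro x m t t1 t2
      refine ⟨rv (a t), ?_, rfl⟩
      rw [List.mem_reverse]
      exact List.mem_map_of_mem (mem_seg a x m t t1 t2)
    refine combine _ _ _ _ (wA.append wC) (wB.append wD) ?_ ?_ ?_ ?_
    · simp only [List.length_append, List.length_reverse, List.length_map, seg_length]; omega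
    · simp only [List.length_append, List.length_reverse, List.length_map, seg_length]; omega
    · simp only [List.length_append, List.length_reverse, List.length_map, seg_length]; omega
    · intro b hb
      obtain ⟨t, t1, t2, rfl⟩ := window i b hb
      by_cases g1 : t < i'
      · exact Or.inl ⟨a t, List.mem_append_left _ (mem_seg a _ _ _ t1 (by omega)), rfl⟩
      by_cases g2 : t < j
      · exact Or.inr ⟨a t, List.mem_append_left _ (mem_seg a _ _ _ (by omega) (by omega)), rfl⟩
      by_cases g3 : t < j'
      · obtain ⟨c, c1, c2⟩ := rvmem j (j' - j) t (by omega) (by omega)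
        exact Or.inl ⟨c, List.mem_append_right _ c1, c2⟩
      · obtain ⟨c, c1, c2⟩ := rvmem j' (i + n - j') t (by omega) (by omega)
        exact Or.inr ⟨c, List.mem_append_right _ c1, c2⟩
  -- shortest closed arc
  have hex : ∃ d, 0 < d ∧ ∃ i, (tl O (a i)).1 = (tl O (a (i + d))).1 :=
    ⟨n, hn, 0, by rw [hper]⟩
  obtain ⟨d, hd'⟩ : ∃ d, d = Nat.find hex := ⟨_, rfl⟩
  have hQ := Nat.find_spec hex
  have hQm : ∀ x, x < d → ¬ _ := fun x hx => Nat.find_min hex (hd' ▸ hx)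
  rw [← hd'] at hQ
  obtain ⟨hd0, i0, hi0⟩ := hQ
  have hmin : ∀ p q, p < q → q < p + d → (tl O (a p)).1 ≠ (tl O (a q)).1 := by
    intro p q h1 h2 h3
    exact hQm (q - p) (by omega) ⟨by omega, p, by rw [Nat.add_sub_cancel' h1.le]; exact h3⟩
  have hdn : d ≤ n := by
    by_contra hh
    exact hQm n (by omega) ⟨hn, 0, by rw [hper]⟩
  rcases Nat.lt_or_ge d n with hlt | hge
  · have e3 : ∀ x, i0 + (x + 1) = i0 + x + 1 := fun x => rfl
    obtain ⟨L, hL1, hL2⟩ := chain_cover O (fun t => a (i0 + t))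
      (fun t => hc (i0 + t)) n d (fun t => by rw [← add_assoc, hper]) hd0 hlt
      (by simpa using hi0)
      (fun p q h1 h2 => hmin _ _ (by omega) (by omega))
      (fun i j h1 h2 => hA _ _ (by omega) (by omega))
      (fun i i' j j' h1 h2 h3 h4 => hB _ _ _ _ (by omega) (by omega) (by omega) (by omega))
      n 0 d (by omega) hd0 (by omega) le_rfl hdn (by simpa using hi0)
      (fun p q h1 h2 h3 => hmin _ _ (by omega) (by omega))
    refine ⟨L, ?_, by omega⟩
    intro b hb
    obtain ⟨t, t1, t2, rfl⟩ := window i0 b hb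
    obtain ⟨C, hC, hC2⟩ := hL1 (t - i0) (by omega) (by omega)
    rw [Nat.add_sub_cancel' t1] at hC2
    exact ⟨C, hC, hC2⟩
  · have hdn' : d = n := by omega
    obtain ⟨m, rfl⟩ : ∃ m, n = m + 1 := ⟨n - 1, by omega⟩
    have e : a (0 + m + 1) = a 0 := hper 0
    refine ⟨[.balanced (mkC O a hc 0 m (by rw [e])
      (fun p q h1 h2 h3 => hmin p q h2 (by omega))) ?_], ?_, ?_⟩
    · rw [mkC_bal, e]
    · intro b hb
      refine ⟨_, List.mem_singleton_self _, ?_⟩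
      change b.1 ∈ Set.range _
      rw [mkC_edge]
      obtain ⟨t, t1, t2, rfl⟩ := window 0 b hb
      exact ⟨t, t1, t2, rfl⟩
    · simp only [List.map_cons, List.map_nil, List.sum_cons, List.sum_nil]
      change m + 1 + 0 ≤ _
      omega

/-! ### Flows -/

section flow

variable [Fintype E] [DecidableEq V]

def sg (b : Bool) : ℤ := if b then 1 else -1

def dv (O : SOrientation G) (f : E → ℤ) (v : V) : ℤ :=
  ∑ e : E, ∑ i : Bool, if G.ends e i = v then sg (O.dir e i) * f e else 0

def dl (s : V × Bool) (v : V) : ℤ := if s.1 = v then sg s.2 else 0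

theorem isFlow_iff (O : SOrientation G) (f : E → ℤ) : IsFlow O f ↔ ∀ v, dv O f v = 0 := by
  unfold IsFlow
  refine forall_congr' fun v => ?_
  rw [← sub_eq_zero, ← Finset.sum_sub_distrib]
  unfold dv
  rw [iff_iff_eq]
  congr 1
  refine Finset.sum_congr rfl fun e _ => ?_
  rw [← Finset.sum_sub_distrib]
  refine Finset.sum_congr rfl fun i _ => ?_
  by_cases h : G.ends e i = v <;> cases h2 : O.dir e i <;> simp [h, sg]

theorem dv_add (O : SOrientation G) (f g : E → ℤ) (v : V) :
    dv O (fun e => f e + g e) v = dv O f v + dv O g v := by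
  unfold dv
  simp only [← Finset.sum_add_distrib]
  refine Finset.sum_congr rfl fun e _ => Finset.sum_congr rfl fun i _ => ?_
  split_ifs <;> ring

open Classical in
noncomputable def ct (l : List (E × Bool)) (e : E) : ℕ := (l.map Prod.fst).count e

open Classical in
theorem ct_cons (a : E × Bool) (l : List (E × Bool)) (e : E) :
    ct (a :: l) e = (if e = a.1 then 1 else 0) + ct l e := by
  unfold ct
  rw [List.map_cons, List.count_cons, add_comm]
  by_cases h : e = a.1
  · simp [h]
  · simp [h, Ne.symm h]

theorem ct_pos {l : List (E × Bool)} {e : E} (h : 0 < ct l e) : ∃ b ∈ l, b.1 = e := by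
  classical
  unfold ct at h
  have := List.count_pos_iff.1 h
  simpa using this

theorem ct_append (l m : List (E × Bool)) (e : E) : ct (l ++ m) e = ct l e + ct m e := by
  classical
  unfold ct
  rw [List.map_append, List.count_append]

theorem sum_ct (l : List (E × Bool)) : ∑ e, ct l e = l.length := by
  classical
  induction l with
  | nil => simp [ct]
  | cons a l ih =>
    simp only [ct_cons, Finset.sum_add_distrib, ih, List.length_cons]
    rw [Finset.sum_ite_eq' Finset.univ a.1 (fun _ => 1)]
    simp [add_comm]

open Classical in
theorem dv_single (O : SOrientation G) (a : E × Bool) (v : V) :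
    dv O (fun e => if e = a.1 then 1 else 0) v = dl (tl O a) v - dl (hd O a) v := by
  unfold dv
  rw [Finset.sum_eq_single a.1]
  · obtain ⟨e, i⟩ := a
    have hn : ∀ b, sg (!b) = - sg b := by intro b; cases b <;> simp [sg]
    cases i <;> by_cases h1 : G.ends e true = v <;> by_cases h2 : G.ends e false = v <;>
      simp [dl, tl, hd, h1, h2, hn, add_comm]
  · intro b _ hb
    simp [hb]
  · simp

theorem dv_walk (O : SOrientation G) (s t : V × Bool) (l : List (E × Bool)) (h : Walk O s l t)
    (v : V) : dv O (fun e => (ct l e : ℤ)) v = dl s v - dl t v := by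
  classical
  induction l generalizing s with
  | nil =>
    simp only [Walk] at h
    subst h
    simp [dv, ct]
  | cons a l ih =>
    obtain ⟨h1, h2⟩ := h
    subst h1
    have e : (fun e => (ct (a :: l) e : ℤ)) =
        fun e => (if e = a.1 then (1 : ℤ) else 0) + (ct l e : ℤ) := by
      funext e
      rw [ct_cons]
      push_cast
      rfl
    rw [e, dv_add O (fun e => if e = a.1 then (1 : ℤ) else 0), dv_single, ih _ h2]
    ring

/-- A trail that is not closed can be extended. -/
theorem extend (O : SOrientation G) (φ : E → ℕ) (hφ : ∀ v, dv O (fun e => (φ e : ℤ)) v = 0)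
    (s t : V × Bool) (l : List (E × Bool)) (h : Walk O s l t) (hle : ∀ e, ct l e ≤ φ e)
    (hst : s ≠ t) : ∃ a, tl O a = t ∧ ct l a.1 < φ a.1 := by
  by_contra hno
  push Not at hno
  have h1 : dv O (fun e => (φ e : ℤ) - ct l e) t.1 = dl t t.1 - dl s t.1 := by
    have h2 := dv_add O (fun e => (φ e : ℤ) - ct l e) (fun e => (ct l e : ℤ)) t.1
    simp only [sub_add_cancel] at h2
    rw [hφ, dv_walk O s t l h] at h2
    linarith
  have h3 : sg t.2 * dv O (fun e => (φ e : ℤ) - ct l e) t.1 ≤ 0 := by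
    unfold dv
    rw [Finset.mul_sum]
    refine Finset.sum_nonpos fun e _ => ?_
    rw [Finset.mul_sum]
    refine Finset.sum_nonpos fun i _ => ?_
    have hx : (0 : ℤ) ≤ (φ e : ℤ) - ct l e := by
      have := hle e
      omega
    by_cases hv : G.ends e i = t.1
    · rw [if_pos hv]
      by_cases hdir : O.dir e i = t.2
      · have := hno (e, i) (Prod.ext hv hdir)
        have h4 := hle e
        have : (φ e : ℤ) - ct l e = 0 := by simp only at this; omega
        beta_reduce
        rw [this]; simp
      · have : sg (O.dir e i) = - sg t.2 := by
          revert hdir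
          cases O.dir e i <;> cases t.2 <;> simp [sg]
        have h5 : sg t.2 * sg t.2 = 1 := by cases t.2 <;> simp [sg]
        rw [this]
        nlinarith
    · rw [if_neg hv]; simp
  rw [h1] at h3
  obtain ⟨u, x⟩ := s
  obtain ⟨w, y⟩ := t
  by_cases huw : u = w
  · subst huw
    revert h3 hst
    cases x <;> cases y <;> simp [dl, sg]
  · revert h3
    cases y <;> simp [dl, sg, huw]

theorem exists_closed (O : SOrientation G) (φ : E → ℕ)
    (hφ : ∀ v, dv O (fun e => (φ e : ℤ)) v = 0) (s : V × Bool) (k : ℕ) :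
    ∀ (t : V × Bool) (l : List (E × Bool)), Walk O s l t → l ≠ [] → (∀ e, ct l e ≤ φ e) →
      ∑ e, φ e - l.length ≤ k → ∃ l', Walk O s l' s ∧ l' ≠ [] ∧ ∀ e, ct l' e ≤ φ e := by
  classical
  induction k with
  | zero => ?_
  | succ k ih => ?_
  all_goals
    intro t l hw hl hle hk
    by_cases hst : s = t
    · subst hst
      exact ⟨l, hw, hl, hle⟩
    obtain ⟨a, ha, hlt⟩ := extend O φ hφ s t l hw hle hst
    have hlen : l.length < ∑ e, φ e := by
      rw [← sum_ct l]
      exact Finset.sum_lt_sum (fun e _ => hle e) ⟨a.1, Finset.mem_univ _, hlt⟩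
  · omega
  · subst ha
    refine ih (hd O a) (l ++ [a]) (hw.append (Walk.single O a)) (by simp) ?_ ?_
    · intro e
      rw [ct_append, ct_cons]
      by_cases he : e = a.1
      · subst he
        simp [ct]
        simpa [ct] using hlt
      · simpa [he, ct] using hle e
    · simp only [List.length_append, List.length_cons, List.length_nil]
      omega

theorem flow_cover (O : SOrientation G) (N : ℕ) : ∀ φ : E → ℕ,
    (∀ v, dv O (fun e => (φ e : ℤ)) v = 0) → ∑ e, φ e = N →
    ∃ L : List (SignedCircuit G), (∀ e, 0 < φ e → ∃ C ∈ L, e ∈ C.edges) ∧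
      (L.map SignedCircuit.length).sum ≤ 2 * N := by
  classical
  induction N using Nat.strong_induction_on with
  | _ N ih => ?_
  intro φ hφ hN
  by_cases hz : ∃ e, 0 < φ e
  swap
  · push Not at hz
    exact ⟨[], fun e he => absurd (hz e) (by omega), by simp⟩
  obtain ⟨e0, he0⟩ := hz
  obtain ⟨l, hw, hl, hle⟩ := exists_closed O φ hφ (tl O (e0, false)) _ _ _
    (Walk.single O (e0, false)) (by simp)
    (by
      intro e
      rw [ct_cons]
      by_cases he : e = e0
      · subst he; simp [ct]; omega
      · simp [he, ct]) le_rfl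
  have hlp : 0 < l.length := List.length_pos_iff.2 hl
  have hsum : ∑ e, (φ e - ct l e) + l.length = N := by
    rw [← sum_ct l, ← Finset.sum_add_distrib, ← hN]
    exact Finset.sum_congr rfl fun e _ => Nat.sub_add_cancel (hle e)
  obtain ⟨L1, a1, b1⟩ := ih (∑ e, (φ e - ct l e)) (by omega) (fun e => φ e - ct l e) (by
    intro v
    have h2 := dv_add O (fun e => ((φ e - ct l e : ℕ) : ℤ)) (fun e => (ct l e : ℤ)) v
    have h3 : (fun e => ((φ e - ct l e : ℕ) : ℤ) + (ct l e : ℤ)) = fun e => (φ e : ℤ) := by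
      funext e
      have := hle e
      omega
    rw [h3, hφ, dv_walk O _ _ l hw] at h2
    linarith) rfl
  obtain ⟨L2, a2, b2⟩ := closed_cover O l.length _ l rfl hw
  refine ⟨L1 ++ L2, ?_, ?_⟩
  · intro e he
    by_cases hc : 0 < ct l e
    · obtain ⟨b, hb, rfl⟩ := ct_pos hc
      obtain ⟨C, hC, hC2⟩ := a2 b hb
      exact ⟨C, by simp [hC], hC2⟩
    · obtain ⟨C, hC, hC2⟩ := a1 e (by omega)
      exact ⟨C, by simp [hC], hC2⟩
  · rw [List.map_append, List.sum_append]
    omega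

end flow

end SCC

/-- If a signed graph admits a nowhere-zero `k`-flow, then it has a signed
circuit cover of total length at most `2(k-1)|E(G)|`. -/
theorem short_signed_circuit_cover {V E : Type} [Fintype E] [DecidableEq V]
    (G : SignedGraph V E) (k : ℕ) (h : HasNZkFlow G k) :
    ∃ 𝒞 : Finset (SignedCircuit G),
      (∀ e : E, ∃ C ∈ 𝒞, e ∈ C.edges) ∧
      ∑ C ∈ 𝒞, C.length ≤ 2 * (k - 1) * Fintype.card E := by
  classical
  obtain ⟨O, φ, hflow, hφ⟩ := h
  rw [SCC.isFlow_iff] at hflow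
  obtain ⟨L, hL1, hL2⟩ := SCC.flow_cover (O.reorient (fun e => decide (φ e < 0))) _
    (fun e => (φ e).natAbs) (by
      intro v
      refine Eq.trans ?_ (hflow v)
      unfold SCC.dv
      refine Finset.sum_congr rfl fun e _ => Finset.sum_congr rfl fun i _ => ?_
      by_cases hv : G.ends e i = v
      · rw [if_pos hv, if_pos hv]
        by_cases hneg : φ e < 0
        · cases hdir : O.dir e i <;>
            simp [SOrientation.reorient, SCC.sg, hneg, hdir, abs_of_neg hneg]
        · have hnn : 0 ≤ φ e := not_lt.1 hneg
          cases hdir : O.dir e i <;>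
            simp [SOrientation.reorient, SCC.sg, hneg, hdir, abs_of_nonneg hnn]
      · rw [if_neg hv, if_neg hv]) rfl
  refine ⟨L.toFinset, ?_, ?_⟩
  · intro e
    obtain ⟨C, hC, hC2⟩ := hL1 e (Int.natAbs_pos.2 (hφ e).1)
    exact ⟨C, List.mem_toFinset.2 hC, hC2⟩
  · have h1 : ∑ C ∈ L.toFinset, C.length ≤ (L.map SignedCircuit.length).sum := by
      rw [Finset.sum_list_map_count]
      refine Finset.sum_le_sum fun C hC => ?_
      have : 0 < L.count C := List.count_pos_iff.2 (List.mem_toFinset.1 hC)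
      rw [smul_eq_mul]
      exact Nat.le_mul_of_pos_left _ this
    have h2 : ∑ e, (φ e).natAbs ≤ Fintype.card E * (k - 1) := by
      have := Finset.sum_le_card_nsmul Finset.univ (fun e => (φ e).natAbs) (k - 1)
        (fun e _ => (hφ e).2)
      simpa using this
    calc _ ≤ _ := h1
      _ ≤ _ := hL2
      _ ≤ 2 * (Fintype.card E * (k - 1)) := Nat.mul_le_mul_left _ h2
      _ = _ := by ring
end

section
/- If Bouchet's conjecture holds, i.e., every flow-admissible signed graph admits a nowhere-zero 6-flow, then every flow-admissible signed graph G has a signed circuit cover of total length at most 10|E(G)|. -/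
variable {V E : Type}

/-! ## Proof -/

namespace BouchetProof

open Finset

/-- Tail state of a directed traversal of an edge. -/
def tl (G : SignedGraph V E) (d : E → Bool → Bool) (a : E × Bool) : V × Bool :=
  (G.ends a.1 a.2, d a.1 a.2)

/-- Head state of a directed traversal of an edge. -/
def hd (G : SignedGraph V E) (d : E → Bool → Bool) (a : E × Bool) : V × Bool :=
  (G.ends a.1 (!a.2), !(d a.1 (!a.2)))

def opp (s : V × Bool) : V × Bool := (s.1, !s.2)

def rv (a : E × Bool) : E × Bool := (a.1, !a.2)

lemma tl_rv (G : SignedGraph V E) (d : E → Bool → Bool) (a : E × Bool) :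
    tl G d (rv a) = opp (hd G d a) := by simp [tl, rv, opp, hd]

lemma hd_rv (G : SignedGraph V E) (d : E → Bool → Bool) (a : E × Bool) :
    hd G d (rv a) = opp (tl G d a) := by simp [tl, rv, opp, hd]

/-- Consistently directed walks from a state to a state. -/
def IsW (G : SignedGraph V E) (d : E → Bool → Bool) :
    V × Bool → V × Bool → List (E × Bool) → Prop
  | s, t, [] => s = t
  | s, t, a :: l => tl G d a = s ∧ IsW G d (hd G d a) t l

lemma IsW.append {G : SignedGraph V E} {d : E → Bool → Bool} {l₁ l₂ : List (E × Bool)} :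
    ∀ {s t u}, IsW G d s t l₁ → IsW G d t u l₂ → IsW G d s u (l₁ ++ l₂) := by
  induction l₁ with
  | nil => intro s t u h h'; simp only [IsW] at h; subst h; simpa using h'
  | cons a l ih => intro s t u h h'; exact ⟨h.1, ih h.2 h'⟩

lemma IsW.rev {G : SignedGraph V E} {d : E → Bool → Bool} {l : List (E × Bool)} :
    ∀ {s t}, IsW G d s t l → IsW G d (opp t) (opp s) (l.map rv).reverse := by
  induction l with
  | nil => intro s t h; simp only [IsW] at h; subst h; simp [IsW]
  | cons a l ih =>
    intro s t h
    simp only [List.map_cons, List.reverse_cons]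
    refine (ih h.2).append ⟨tl_rv G d a, ?_⟩
    simp only [IsW]
    rw [hd_rv, h.1]

open Classical in
/-- How often a walk uses an edge. -/
noncomputable def use (l : List (E × Bool)) (e : E) : ℕ := (l.map Prod.fst).count e

lemma use_nil (e : E) : use ([] : List (E × Bool)) e = 0 := by simp [use]
lemma use_append (l₁ l₂ : List (E × Bool)) (e : E) :
    use (l₁ ++ l₂) e = use l₁ e + use l₂ e := by simp [use]
open Classical in
lemma use_cons (a : E × Bool) (l : List (E × Bool)) (e : E) :
    use (a :: l) e = use l e + if a.1 = e then 1 else 0 := by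
  simp [use, List.count_cons]
lemma use_rev (l : List (E × Bool)) (e : E) : use (l.map rv).reverse e = use l e := by
  have : (Prod.fst ∘ rv : E × Bool → E) = Prod.fst := by funext a; rfl
  simp [use, this]
open Classical in
lemma use_pos {l : List (E × Bool)} {e : E} (h : 0 < use l e) : ∃ a ∈ l, a.1 = e := by
  unfold use at h
  rw [List.count_pos_iff] at h
  simpa using h

lemma sum_use [Fintype E] (l : List (E × Bool)) : ∑ e, use l e = l.length := by
  induction l with
  | nil => simp [use_nil]
  | cons a l ih =>
    classical
    simp only [use_cons, Finset.sum_add_distrib, ih]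
    rw [Finset.sum_ite_eq]
    simp

open Classical in
/-- signed incidence of a state at `v` -/
noncomputable def tau (v : V) (s : V × Bool) : ℤ :=
  if s.1 = v then (if s.2 then 1 else -1) else 0

/-- signed incidence of an edge at `v` -/
noncomputable def inc (G : SignedGraph V E) (d : E → Bool → Bool) (v : V) (e : E) : ℤ :=
  tau v (G.ends e false, d e false) + tau v (G.ends e true, d e true)

lemma inc_eq (G : SignedGraph V E) (d : E → Bool → Bool) (v : V) (a : E × Bool) :
    inc G d v a.1 = tau v (tl G d a) - tau v (hd G d a) := by
  obtain ⟨e, i⟩ := a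
  cases i <;> simp [inc, tl, hd, tau] <;> split_ifs <;> simp_all

lemma sum_use_inc [Fintype E] (G : SignedGraph V E) (d : E → Bool → Bool) (v : V)
    (l : List (E × Bool)) : ∀ {s t}, IsW G d s t l →
    ∑ e, (use l e : ℤ) * inc G d v e = tau v s - tau v t := by
  induction l with
  | nil => intro s t h; simp only [IsW] at h; subst h; simp [use_nil]
  | cons a l ih =>
    intro s t h
    classical
    have h2 := ih h.2
    simp only [use_cons, Nat.cast_add, add_mul, Finset.sum_add_distrib, h2]
    have h3 := inc_eq G d v a
    rw [h.1] at h3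
    have h4 : ∑ e, (((if a.1 = e then 1 else 0 : ℕ) : ℤ) * inc G d v e) = inc G d v a.1 := by
      rw [Finset.sum_eq_single a.1]
      · simp
      · intro b _ hb; simp [hb.symm]
      · simp
    rw [h4]; linarith

/-- Kirchhoff. -/
def Kir [Fintype E] (G : SignedGraph V E) (d : E → Bool → Bool) (f : E → ℕ) : Prop :=
  ∀ v, ∑ e, (f e : ℤ) * inc G d v e = 0

lemma extend [Fintype E] {G : SignedGraph V E} {d : E → Bool → Bool} {f : E → ℕ}
    (hf : Kir G d f) {l : List (E × Bool)} {s t} (h : IsW G d s t l) (hst : s ≠ t)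
    (hu : ∀ e, use l e ≤ f e) :
    ∃ a, tl G d a = t ∧ ∀ e, use (l ++ [a]) e ≤ f e := by
  classical
  by_contra hcon
  push Not at hcon
  have key : ∀ e i, G.ends e i = t.1 → d e i = t.2 → f e = use l e := by
    intro e i h1 h2
    obtain ⟨e', he'⟩ := hcon (e, i) (by simp [tl, h1, h2])
    simp only [use_append, use_cons, use_nil] at he'
    have := hu e'
    split_ifs at he' with h3
    · subst h3
      omega
    · omega
  have h1 := sum_use_inc G d t.1 l h
  have h2 := hf t.1
  have h3 : ∑ e, ((f e : ℤ) - use l e) * inc G d t.1 e = tau t.1 t - tau t.1 s := by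
    simp only [sub_mul, Finset.sum_sub_distrib]; linarith
  obtain ⟨u, b⟩ := t
  have hs : tau u s ≠ tau u (u, b) := by
    obtain ⟨x, c⟩ := s
    simp only [tau]
    intro h
    apply hst
    by_cases hx : x = u <;> cases b <;> cases c <;> simp_all
  have hs1 : -1 ≤ tau u s ∧ tau u s ≤ 1 := by
    simp only [tau]; split_ifs <;> simp
  cases b
  · have : 0 ≤ ∑ e, ((f e : ℤ) - use l e) * inc G d u e := by
      apply Finset.sum_nonneg
      intro e _
      by_cases h4 : f e = use l e
      · simp [h4]
      · have a1 := fun h => mt (key e false h) 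
        have a2 := fun h => mt (key e true h)
        apply mul_nonneg
        · have := hu e; omega
        · simp only [inc, tau]
          simp only at a1 a2
          split_ifs <;> simp_all
    simp only [tau] at *
    split_ifs at * <;> simp_all <;> omega
  · have : 0 ≤ ∑ e, ((f e : ℤ) - use l e) * (- inc G d u e) := by
      apply Finset.sum_nonneg
      intro e _
      by_cases h4 : f e = use l e
      · simp [h4]
      · have a1 := fun h => mt (key e false h) 
        have a2 := fun h => mt (key e true h)
        apply mul_nonneg
        · have := hu e; omega
        · simp only [inc, tau]
          simp only at a1 a2
          split_ifs <;> simp_all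
    simp only [mul_neg, Finset.sum_neg_distrib] at this
    simp only [tau] at *
    split_ifs at * <;> simp_all <;> omega

/-- Closed admissible walks. -/
def Cl [Fintype E] (G : SignedGraph V E) (d : E → Bool → Bool) (f : E → ℕ)
    (l : List (E × Bool)) : Prop :=
  l ≠ [] ∧ (∃ s, IsW G d s s l) ∧ ∀ e, use l e ≤ f e

lemma exists_closed [Fintype E] {G : SignedGraph V E} {d : E → Bool → Bool} {f : E → ℕ}
    (hf : Kir G d f) {e₀ : E} (he : 0 < f e₀) : ∃ l, Cl G d f l := by
  classical
  by_contra hcon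
  push Not at hcon
  have : ∀ n : ℕ, ∃ l s t, l.length = n + 1 ∧ IsW G d s t l ∧ ∀ e, use l e ≤ f e := by
    intro n
    induction n with
    | zero =>
      refine ⟨[(e₀, true)], _, _, rfl, ⟨rfl, rfl⟩, ?_⟩
      intro e
      simp only [use_cons, use_nil]
      split_ifs with h
      · subst h; omega
      · omega
    | succ n ih =>
      obtain ⟨l, s, t, hl, hw, hu⟩ := ih
      have hst : s ≠ t := by
        rintro rfl
        exact hcon l ⟨by rintro rfl; simp at hl, ⟨s, hw⟩, hu⟩
      obtain ⟨a, ha, hu'⟩ := extend hf hw hst hu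
      exact ⟨l ++ [a], s, hd G d a, by simp [hl], hw.append ⟨ha, rfl⟩, hu'⟩
  obtain ⟨l, s, t, hl, -, hu⟩ := this (∑ e, f e)
  have := Finset.sum_le_sum (fun e (_ : e ∈ Finset.univ) => hu e)
  rw [sum_use] at this
  omega

/-- Segment of a periodic walk. -/
def seg (w : ℕ → E × Bool) (i : ℕ) : ℕ → List (E × Bool)
  | 0 => []
  | n + 1 => seg w i n ++ [w (i + n)]

lemma seg_length (w : ℕ → E × Bool) (i n : ℕ) : (seg w i n).length = n := by
  induction n with
  | zero => rfl
  | succ n ih => simp [seg, ih]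

lemma seg_add (w : ℕ → E × Bool) (i n m : ℕ) :
    seg w i (n + m) = seg w i n ++ seg w (i + n) m := by
  induction m with
  | zero => simp [seg]
  | succ m ih => rw [← add_assoc, seg, ih, seg]; simp [add_assoc]

lemma seg_isW {G : SignedGraph V E} {d : E → Bool → Bool} {w : ℕ → E × Bool}
    (hc : ∀ n, hd G d (w n) = tl G d (w (n + 1))) (i n : ℕ) :
    IsW G d (tl G d (w i)) (tl G d (w (i + n))) (seg w i n) := by
  induction n with
  | zero => simp [seg, IsW]
  | succ n ih => exact ih.append ⟨rfl, hc _⟩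

lemma seg_rot {w : ℕ → E × Bool} {N : ℕ} (per : ∀ n, w (n + N) = w n) (i : ℕ) (e : E) :
    use (seg w i N) e = use (seg w 0 N) e := by
  induction i with
  | zero => rfl
  | succ i ih =>
    rw [← ih]
    have h1 := seg_add w i 1 N
    have h2 : seg w i (1 + N) = seg w i N ++ [w (i + N)] := by rw [add_comm]; rfl
    rw [h2, per] at h1
    have := congrArg (fun l => use l e) h1
    simp only [use_append, seg, add_zero, use_nil] at this
    omega

/-- The combinatorial properties of a minimal closed walk. -/
structure MW (G : SignedGraph V E) (d : E → Bool → Bool) (N : ℕ) (w : ℕ → E × Bool) : Prop where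
  pos : 0 < N
  per : ∀ n, w (n + N) = w n
  chain : ∀ n, hd G d (w n) = tl G d (w (n + 1))
  F1 : ∀ i j, i < j → j < i + N → tl G d (w i) ≠ tl G d (w j)
  F2 : ∀ i j k l, i < j → j < k → k < l → l < i + N →
    (tl G d (w i)).1 = (tl G d (w k)).1 → (tl G d (w j)).1 = (tl G d (w l)).1 → False

lemma isW_get {G : SignedGraph V E} {d : E → Bool → Bool} {l : List (E × Bool)} :
    ∀ {s t}, IsW G d s t l → 
    (∀ (h : 0 < l.length), tl G d l[0] = s) ∧
    (∀ (h : 0 < l.length), hd G d (l[l.length - 1]) = t) ∧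
    ∀ n (h : n + 1 < l.length), hd G d l[n] = tl G d l[n+1] := by
  induction l with
  | nil => intro s t h; simp
  | cons a l ih =>
    intro s t h
    obtain ⟨h1, h2, h3⟩ := ih h.2
    refine ⟨fun _ => h.1, ?_, ?_⟩
    · intro _
      rcases l with _ | ⟨b, l⟩
      · exact h.2
      · have := h2 (by simp)
        simpa using this
    · intro n hn
      rcases n with _ | n
      · simp only [List.getElem_cons_zero, List.getElem_cons_succ]
        exact (h1 (by simpa using hn)).symm
      · simp only [List.getElem_cons_succ]
        exact h3 n (by simpa using hn)

lemma exists_MW [Fintype E] {G : SignedGraph V E} {d : E → Bool → Bool} {f : E → ℕ}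
    (hf : Kir G d f) {e₀ : E} (he : 0 < f e₀) :
    ∃ l w, Cl G d f l ∧ MW G d l.length w ∧ ∀ a ∈ l, ∃ n < l.length, w n = a := by
  classical
  have hex : ∃ n, ∃ l, Cl G d f l ∧ l.length = n := by
    obtain ⟨l, hl⟩ := exists_closed hf he
    exact ⟨_, l, hl, rfl⟩
  obtain ⟨l, hl, hlN⟩ := Nat.find_spec hex
  have hmin : ∀ l', Cl G d f l' → l.length ≤ l'.length := by
    intro l' h'
    rw [hlN]
    exact Nat.find_min' hex ⟨l', h', rfl⟩
  have hpos : 0 < l.length := List.length_pos_of_ne_nil hl.1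
  obtain ⟨w, hw⟩ : ∃ w : ℕ → E × Bool, ∀ n, w n = l[n % l.length]'(Nat.mod_lt _ hpos) :=
    ⟨_, fun _ => rfl⟩
  have hper : ∀ n, w (n + l.length) = w n := by intro n; simp [hw]
  have hw' : ∀ n (h : n < l.length), w n = l[n] := by
    intro n h; rw [hw]; simp [Nat.mod_eq_of_lt h]
  obtain ⟨s, hs⟩ := hl.2.1
  obtain ⟨g1, g2, g3⟩ := isW_get hs
  have hchain : ∀ n, hd G d (w n) = tl G d (w (n + 1)) := by
    intro n
    have hr := Nat.mod_lt n hpos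
    by_cases h : n % l.length + 1 < l.length
    · have : (n + 1) % l.length = n % l.length + 1 := by
        rw [Nat.add_mod, Nat.mod_eq_of_lt (a := 1) (by omega), Nat.mod_eq_of_lt h]
      have e2 : w (n + 1) = l[n % l.length + 1] := by rw [hw]; simp only [this]
      rw [e2, hw, g3 _ h]
    · have h0 : n % l.length = l.length - 1 := by omega
      have : (n + 1) % l.length = 0 := by
        have := Nat.div_add_mod n l.length
        have h5 : n + 1 = l.length * (n / l.length + 1) := by
          rw [mul_add]; omega
        rw [h5]; simp
      have e2 : w (n + 1) = l[0] := by rw [hw]; simp only [this]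
      have e1 : w n = l[l.length - 1] := by rw [hw]; simp only [h0]
      rw [e1, e2, g1 hpos, g2 hpos]
  have hseg0 : seg w 0 l.length = l := by
    have : ∀ n ≤ l.length, seg w 0 n = l.take n := by
      intro n hn
      induction n with
      | zero => simp [seg]
      | succ n ih =>
        rw [seg, ih (by omega), zero_add, hw' n (by omega)]
        simp
    rw [this _ le_rfl]; simp
  have huse : ∀ i e, use (seg w i l.length) e ≤ f e := by
    intro i e
    rw [seg_rot hper, hseg0]; exact hl.2.2 e
  refine ⟨l, w, hl, ⟨hpos, hper, hchain, ?_, ?_⟩, ?_⟩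
  · intro i j hij hj heq
    have := hmin (seg w i (j - i)) ⟨?_, ⟨tl G d (w i), ?_⟩, ?_⟩
    · rw [seg_length] at this; omega
    · intro h; have := congrArg List.length h; rw [seg_length] at this; simp at this; omega
    · have := seg_isW hchain i (j - i)
      rwa [show i + (j - i) = j by omega, ← heq] at this
    · intro e
      have h1 := huse i e
      rw [show l.length = (j - i) + (l.length - (j - i)) by omega, seg_add, use_append] at h1
      omega
  · intro i j k m hij hjk hkm hm hik hjm
    have hF1 : ∀ i j, i < j → j < i + l.length → (tl G d (w i)).1 = (tl G d (w j)).1 →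
        opp (tl G d (w j)) = tl G d (w i) := by
      intro i j hij hj hv
      have : tl G d (w i) ≠ tl G d (w j) := by
        intro heq
        have := hmin (seg w i (j - i)) ⟨?_, ⟨tl G d (w i), ?_⟩, ?_⟩
        · rw [seg_length] at this; omega
        · intro h; have := congrArg List.length h; rw [seg_length] at this; simp at this; omega
        · have := seg_isW hchain i (j - i)
          rwa [show i + (j - i) = j by omega, ← heq] at this
        · intro e
          have h1 := huse i e
          rw [show l.length = (j - i) + (l.length - (j - i)) by omega, seg_add, use_append] at h1
          omega
      generalize tl G d (w i) = p at *
      generalize tl G d (w j) = q at *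
      obtain ⟨p1, p2⟩ := p
      obtain ⟨q1, q2⟩ := q
      simp only at hv
      subst hv
      cases p2 <;> cases q2 <;> simp_all [opp]
    have e1 := hF1 i k (by omega) (by omega) hik
    have e2 := hF1 j m (by omega) (by omega) hjm
    have e2' : opp (tl G d (w j)) = tl G d (w m) := by rw [← e2]; simp [opp]
    have B := (seg_isW hchain j (k - j)).rev
    rw [show j + (k - j) = k by omega, e1, e2'] at B
    have D := seg_isW hchain m (i + l.length - m)
    rw [show m + (i + l.length - m) = i + l.length by omega, hper] at D
    have := hmin (((seg w j (k - j)).map rv).reverse ++ seg w m (i + l.length - m))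
      ⟨?_, ⟨_, B.append D⟩, ?_⟩
    · simp only [List.length_append, List.length_reverse, List.length_map, seg_length] at this
      omega
    · intro h; have := congrArg List.length h
      simp only [List.length_append, List.length_reverse, List.length_map, seg_length,
        List.length_nil] at this
      omega
    · intro e
      have h1 := huse i e
      rw [show l.length = (j - i) + ((k - j) + ((m - k) + (i + l.length - m))) by omega,
        seg_add, seg_add, seg_add, use_append, use_append, use_append,
        show i + (j - i) = j by omega, show j + (k - j) = k by omega,
        show k + (m - k) = m by omega] at h1
      rw [use_append, use_rev]
      omega
  · intro a ha
    obtain ⟨n, hn, rfl⟩ := List.getElem_of_mem ha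
    exact ⟨n, hn, hw' n hn⟩

end BouchetProof

namespace BouchetProof

open Finset

/-- Vertex at a position of the walk. -/
def vx (G : SignedGraph V E) (w : ℕ → E × Bool) (n : ℕ) : V := G.ends (w n).1 (w n).2

section
variable {G : SignedGraph V E} {d : E → Bool → Bool} {N : ℕ} {w : ℕ → E × Bool}

lemma MW.vx_per (M : MW G d N w) (n : ℕ) : vx G w (n + N) = vx G w n := by
  simp [vx, M.per]

lemma MW.tgt (M : MW G d N w) (n : ℕ) : G.ends (w n).1 (!(w n).2) = vx G w (n + 1) :=
  congrArg Prod.fst (M.chain n)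

lemma MW.st_succ (M : MW G d N w) (n : ℕ) :
    (!(d (w n).1 (!(w n).2))) = d (w (n+1)).1 (w (n+1)).2 :=
  congrArg Prod.snd (M.chain n)

lemma MW.F1' (M : MW G d N w) {i j : ℕ} (hij : i < j) (hj : j < i + N)
    (h : vx G w i = vx G w j) : d (w i).1 (w i).2 ≠ d (w j).1 (w j).2 := by
  intro h2
  exact M.F1 i j hij hj (Prod.ext h h2)

lemma MW.cross (M : MW G d N w) {i j k l : ℕ} (h1 : i < j) (h2 : j < k) (h3 : k < l)
    (h4 : l < i + N) (h5 : vx G w i = vx G w k) (h6 : vx G w j = vx G w l) : False :=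
  M.F2 i j k l h1 h2 h3 h4 h5 h6

lemma MW.triple (M : MW G d N w) {i j k : ℕ} (hij : i < j) (hjk : j < k) (hk : k < i + N)
    (h : vx G w i = vx G w j) (h' : vx G w j = vx G w k) : False := by
  have h1 := M.F1' hij (by omega) h
  have h2 := M.F1' hjk (by omega) h'
  have h3 := M.F1' (hij.trans hjk) hk (h.trans h')
  revert h1 h2 h3
  generalize d (w i).1 (w i).2 = x
  generalize d (w j).1 (w j).2 = y
  generalize d (w k).1 (w k).2 = z
  cases x <;> cases y <;> cases z <;> simp

lemma MW.edge_ne (M : MW G d N w) {i j : ℕ} (hij : i < j) (hj : j < i + N)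
    (h : (w i).1 = (w j).1) :
    i + 1 < j ∧ vx G w (i + 1) = vx G w j ∧ vx G w (j + 1) = vx G w i := by
  have hne : (w j).2 = !(w i).2 := by
    by_contra hc
    have : (w i).2 = (w j).2 := by
      revert hc
      generalize (w i).2 = x
      generalize (w j).2 = y
      cases x <;> cases y <;> simp
    have hw : w i = w j := Prod.ext h this
    exact M.F1 i j hij hj (by rw [hw])
  refine ⟨?_, ?_, ?_⟩
  · by_contra hc
    have hj1 : j = i + 1 := by omega
    subst hj1
    have := M.st_succ i
    rw [← h, hne] at this
    simp at this
  · rw [← M.tgt i, vx, ← h, hne]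
  · rw [← M.tgt j, vx, ← h, hne]; simp

/-- Number of negative edges in a stretch of the walk is even iff the state is the same. -/
lemma MW.parity (M : MW G d N w) (hd : ∀ e, G.sign e = xor (d e false) (d e true)) (a n : ℕ) :
    Even ((Finset.range n).filter (fun m => G.sign (w (a + m)).1 = false)).card ↔
      d (w a).1 (w a).2 = d (w (a + n)).1 (w (a + n)).2 := by
  induction n with
  | zero => simp
  | succ n ih =>
    rw [Finset.range_add_one, Finset.filter_insert]
    have h1 := M.st_succ (a + n)
    rw [← add_assoc, ← h1]
    have h2 : G.sign (w (a + n)).1 =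
        xor (d (w (a + n)).1 (w (a + n)).2) (d (w (a + n)).1 (!(w (a + n)).2)) := by
      rw [hd]; cases (w (a + n)).2 <;> simp [Bool.xor_comm]
    rw [h2]
    revert ih
    generalize d (w a).1 (w a).2 = x
    generalize d (w (a + n)).1 (w (a + n)).2 = y
    generalize d (w (a + n)).1 (!(w (a + n)).2) = z
    intro ih
    split_ifs with h
    · rw [Finset.card_insert_of_notMem (by simp), Nat.even_add_one, ih]
      revert h; cases x <;> cases y <;> cases z <;> simp
    · rw [ih]
      revert h; cases x <;> cases y <;> cases z <;> simp

/-- Circuit from a stretch. -/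
def mkC (M : MW G d N w) (a n : ℕ) (h : vx G w a = vx G w (a + (n + 1)))
    (hv : ∀ i j, i < j → j ≤ n → vx G w (a + i) ≠ vx G w (a + j))
    (he : ∀ i j, i < j → j ≤ n → (w (a + i)).1 ≠ (w (a + j)).1) : Circuit G where
  n := n
  vtx := fun i => vx G w (a + i)
  edge := fun i => (w (a + i)).1
  half := fun i => (w (a + i)).2
  vtx_inj := by
    intro i j hij
    rcases lt_trichotomy i j with h' | h' | h'
    · exact absurd hij (hv i j h' (by omega))
    · exact h'
    · exact absurd hij.symm (hv j i h' (by omega))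
  edge_inj := by
    intro i j hij
    rcases lt_trichotomy i j with h' | h' | h'
    · exact absurd hij (he i j h' (by omega))
    · exact h'
    · exact absurd hij.symm (he j i h' (by omega))
  ends_src := fun i => rfl
  ends_tgt := by
    intro i
    rw [M.tgt, Fin.val_add_one]
    split_ifs with hl
    · subst hl; simp [h]; rfl
    · rfl

lemma mkC_balanced (M : MW G d N w) (hd : ∀ e, G.sign e = xor (d e false) (d e true))
    (a n : ℕ) (h) (hv) (he) :
    (mkC M a n h hv he).Balanced ↔
      d (w a).1 (w a).2 = d (w (a + (n + 1))).1 (w (a + (n + 1))).2 := by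
  rw [← M.parity hd a (n + 1)]
  unfold Circuit.Balanced
  rw [Finset.card_filter, Finset.card_filter]
  rw [← Fin.sum_univ_eq_sum_range (fun m => if G.sign (w (a + m)).1 = false then 1 else 0)]
  rfl

/-- A leaf: a minimal closed stretch. -/
structure Lf (G : SignedGraph V E) (w : ℕ → E × Bool) (N a b : ℕ) : Prop where
  lt : a < b
  ltN : b < a + N
  eq : vx G w a = vx G w b
  inj : ∀ i j, a ≤ i → i < j → j < b → vx G w i ≠ vx G w j

lemma MW.edge_inj (M : MW G d N w) {a b : ℕ} (hb : b ≤ a + N)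
    (hi : ∀ i j, a ≤ i → i < j → j < b → vx G w i ≠ vx G w j) (i j : ℕ) (h1 : a ≤ i)
    (h2 : i < j) (h3 : j < b) : (w i).1 ≠ (w j).1 := by
  intro h
  obtain ⟨h4, h5, h6⟩ := M.edge_ne h2 (by omega) h
  exact hi _ _ (by omega) h4 h3 h5

lemma MW.leaf_edge (M : MW G d N w) {a b : ℕ} (L : Lf G w N a b) (i j : ℕ) (h1 : a ≤ i)
    (h2 : i < b) (h3 : b ≤ j) (h4 : j < a + N) : (w i).1 ≠ (w j).1 := by
  intro h
  obtain ⟨h5, h6, h7⟩ := M.edge_ne (by omega) (by omega) h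
  have hib : i + 1 = b := by
    by_contra hne
    rcases Nat.eq_or_lt_of_le h3 with h8 | h8
    · subst h8
      exact L.inj a (i + 1) le_rfl (by omega) (by omega) (L.eq.trans h6.symm)
    · exact M.cross (i := a) (j := i + 1) (k := b) (l := j) (by omega) (by omega) h8 h4 L.eq h6
  subst hib
  exact M.triple L.lt h5 h4 L.eq h6

lemma MW.next (M : MW G d N w) (hd : ∀ e, G.sign e = xor (d e false) (d e true))
    {a b : ℕ} (L : Lf G w N a b) :
    ∃ c e, Lf G w N c e ∧ b ≤ c ∧
      (∀ i j, b ≤ i → i < j → j < e → vx G w i ≠ vx G w j) ∧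
      ∃ S : SignedCircuit G, S.length = e - a ∧ ∀ i, a ≤ i → i < e → (w i).1 ∈ S.edges := by
  classical
  have hex : ∃ e, ∃ c, b ≤ c ∧ c < e ∧ vx G w c = vx G w e := by
    refine ⟨a + N, b, le_rfl, L.ltN, ?_⟩
    rw [M.vx_per, L.eq]
  obtain ⟨c, hbc, hce, hv⟩ := Nat.find_spec hex
  have hmin : ∀ i j, b ≤ i → i < j → j < Nat.find hex → vx G w i ≠ vx G w j :=
    fun i j h1 h2 h3 h4 => Nat.find_min hex h3 ⟨i, h1, h2, h4⟩
  have heN : Nat.find hex ≤ a + N :=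
    Nat.find_min' hex ⟨b, le_rfl, L.ltN, by rw [M.vx_per, L.eq]⟩
  generalize Nat.find hex = e at *
  have hL := L.lt
  have hLN := L.ltN
  have L2 : Lf G w N c e := ⟨hce, by omega, hv, fun i j h1 h2 h3 => hmin i j (by omega) h2 h3⟩
  refine ⟨c, e, L2, hbc, hmin, ?_⟩
  have hEL := M.edge_inj (a := a) (b := b) (by omega) L.inj
  have hEM := M.edge_inj (a := b) (b := e) (by omega) hmin
  have hA : a + (b - a - 1 + 1) = b := by omega
  have hC : c + (e - c - 1 + 1) = e := by omega
  have hm1 : ∀ i j, a ≤ i → i < b → b ≤ j → j < a + N → vx G w i = vx G w j → i = a ∧ j = b := by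
    intro i j h1 h2 h3 h4 h5
    rcases Nat.eq_or_lt_of_le h1 with h6 | h6
    · subst h6
      refine ⟨rfl, ?_⟩
      by_contra h7
      exact M.triple (i := a) (j := b) (k := j) (by omega) (by omega) h4 L.eq (L.eq.symm.trans h5)
    · exfalso
      rcases Nat.eq_or_lt_of_le h3 with h7 | h7
      · subst h7
        exact L.inj a i le_rfl h6 h2 (L.eq.trans h5.symm)
      · exact M.cross h6 h2 h7 h4 L.eq h5
  let C₁ := mkC M a (b - a - 1) (by rw [hA]; exact L.eq)
    (fun i j h1 h2 => L.inj _ _ (by omega) (by omega) (by omega))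
    (fun i j h1 h2 => hEL _ _ (by omega) (by omega) (by omega))
  let C₂ := mkC M c (e - c - 1) (by rw [hC]; exact hv)
    (fun i j h1 h2 => L2.inj _ _ (by omega) (by omega) (by omega))
    (fun i j h1 h2 => hEM _ _ (by omega) (by omega) (by omega))
  let P : GPath G :=
    { m := c - b
      vtx := fun i => vx G w (b + i)
      edge := fun i => (w (b + i)).1
      half := fun i => (w (b + i)).2
      vtx_inj := by
        intro i j hij
        have hi := i.2
        have hj := j.2
        rcases lt_trichotomy i j with h' | h' | h'
        · exact absurd hij (hmin _ _ (by omega) (by omega) (by omega))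
        · exact h'
        · exact absurd hij.symm (hmin _ _ (by omega) (by omega) (by omega))
      edge_inj := by
        intro i j hij
        have hi := i.2
        have hj := j.2
        rcases lt_trichotomy i j with h' | h' | h'
        · exact absurd hij (hEM _ _ (by omega) (by omega) (by omega))
        · exact h'
        · exact absurd hij.symm (hEM _ _ (by omega) (by omega) (by omega))
      ends_src := fun i => rfl
      ends_tgt := fun i => M.tgt _ }
  have r1 : ∀ x, x ∈ Set.range C₁.vtx → ∃ i, a ≤ i ∧ i < b ∧ x = vx G w i := by
    rintro x ⟨i, rfl⟩
    have := i.2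
    have e1 : C₁.n = b - a - 1 := rfl
    exact ⟨a + i, by omega, by omega, rfl⟩
  have r2 : ∀ x, x ∈ Set.range C₂.vtx → ∃ i, c ≤ i ∧ i < e ∧ x = vx G w i := by
    rintro x ⟨i, rfl⟩
    have := i.2
    have e1 : C₂.n = e - c - 1 := rfl
    exact ⟨c + i, by omega, by omega, rfl⟩
  have b1 : ¬ C₁.Balanced := by
    rw [mkC_balanced M hd, hA]; exact M.F1' L.lt L.ltN L.eq
  have b2 : ¬ C₂.Balanced := by
    rw [mkC_balanced M hd, hC]; exact M.F1' L2.lt L2.ltN L2.eq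
  let S : SignedCircuit G := SignedCircuit.bicircuit C₁ C₂ P b1 b2
    ⟨(0 : Fin (b - a - 1 + 1)), by
      change vx G w (a + 0) = vx G w (b + 0)
      exact L.eq⟩
    ⟨(0 : Fin (e - c - 1 + 1)), by
      change vx G w (c + 0) = vx G w (b + (c - b))
      congr 1; omega⟩
    (by
      intro x h1 h2
      obtain ⟨i, i1, i2, rfl⟩ := r1 x h1
      obtain ⟨j, j1, j2, hj⟩ := r2 _ h2
      obtain ⟨k1, k2⟩ := hm1 i j i1 i2 (by omega) (by omega) hj
      refine ⟨?_, ?_⟩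
      · change c - b = 0
        omega
      · rw [hj, k2]; rfl)
    (by
      intro k k0 kl
      have kk := k.2
      have e1 : P.m = c - b := rfl
      have k0' : (k : ℕ) ≠ 0 := fun h => k0 (Fin.ext h)
      have kl' : (k : ℕ) ≠ c - b := fun h => kl (Fin.ext h)
      constructor
      · intro h
        obtain ⟨i, i1, i2, hi⟩ := r1 _ h
        obtain ⟨k1, k2⟩ := hm1 i (b + k) i1 i2 (by omega) (by omega) hi.symm
        omega
      · intro h
        obtain ⟨i, i1, i2, hi⟩ := r2 _ h
        exact hmin (b + k) i (by omega) (by omega) (by omega) hi)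
    (by
      intro i j
      have hi := i.2
      have hj := j.2
      have e1 : C₁.n = b - a - 1 := rfl
      have e2 : C₂.n = e - c - 1 := rfl
      exact M.leaf_edge L (a + i) (c + j) (by omega) (by omega) (by omega) (by omega))
    (by
      intro i j
      have hi := i.2
      have hj := j.2
      have e1 : C₁.n = b - a - 1 := rfl
      have e2 : P.m = c - b := rfl
      exact (M.leaf_edge L (a + j) (b + i) (by omega) (by omega) (by omega) (by omega)).symm)
    (by
      intro i j
      have hi := i.2
      have hj := j.2
      have e1 : C₂.n = e - c - 1 := rfl
      have e2 : P.m = c - b := rfl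
      exact hEM (b + i) (c + j) (by omega) (by omega) (by omega))
  refine ⟨S, ?_, ?_⟩
  · change (b - a - 1 + 1) + (e - c - 1 + 1) + (c - b) = e - a
    omega
  · intro i h1 h2
    change (w i).1 ∈ Set.range C₁.edge ∪ Set.range C₂.edge ∪ Set.range P.edge
    by_cases h3 : i < b
    · left; left
      refine ⟨(⟨i - a, by omega⟩ : Fin (b - a - 1 + 1)), ?_⟩
      change (w (a + (i - a))).1 = _
      rw [show a + (i - a) = i by omega]
    · by_cases h4 : i < c
      · right
        refine ⟨(⟨i - b, by omega⟩ : Fin (c - b)), ?_⟩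
        change (w (b + (i - b))).1 = _
        rw [show b + (i - b) = i by omega]
      · left; right
        refine ⟨(⟨i - c, by omega⟩ : Fin (e - c - 1 + 1)), ?_⟩
        change (w (c + (i - c))).1 = _
        rw [show c + (i - c) = i by omega]

lemma MW.leaf_le (M : MW G d N w) {a b p T : ℕ} (L : Lf G w N a b) (LT : Lf G w N p T)
    (h : b < T) : b ≤ p := by
  by_contra hc
  have hL := L.lt
  have hLN := L.ltN
  rcases lt_trichotomy p a with h1 | h1 | h1
  · exact LT.inj a b (by omega) hL h L.eq
  · subst h1
    exact LT.inj p b le_rfl hL h L.eq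
  · rcases lt_trichotomy T (a + N) with h2 | h2 | h2
    · exact M.cross h1 (by omega) h h2 L.eq LT.eq
    · refine L.inj a p le_rfl h1 (by omega) ?_
      rw [LT.eq, h2, M.vx_per]
    · exact LT.inj b (a + N) (by omega) hLN h2 (by rw [M.vx_per, L.eq])

lemma MW.chainCover (M : MW G d N w) (hd : ∀ e, G.sign e = xor (d e false) (d e true))
    {p T : ℕ} (LT : Lf G w N p T) : ∀ n a b, Lf G w N a b → b ≤ T → T - b = n →
    ∃ l : List (SignedCircuit G), (∀ i, b ≤ i → i < T → ∃ C ∈ l, (w i).1 ∈ C.edges) ∧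
      (l.map SignedCircuit.length).sum + b + a ≤ T + p := by
  intro n
  induction n using Nat.strong_induction_on with
  | _ n ih =>
    intro a b L hb hn
    rcases Nat.eq_or_lt_of_le hb with h | h
    · subst h
      refine ⟨[], fun i h1 h2 => by omega, ?_⟩
      simp only [List.map_nil, List.sum_nil]
      have : a ≤ p := by
        by_contra hc
        exact LT.inj p a le_rfl (by omega) L.lt (LT.eq.trans L.eq.symm)
      omega
    · obtain ⟨c, e, L2, hbc, hmin, S, hS, hcov⟩ := M.next hd L
      have hbp := M.leaf_le L LT h
      have heT : e ≤ T := by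
        by_contra hc
        exact hmin p T hbp LT.lt (by omega) LT.eq
      have := L2.lt
      have := L.lt
      obtain ⟨l, hl, hsum⟩ := ih (T - e) (by omega) c e L2 heT rfl
      refine ⟨S :: l, ?_, ?_⟩
      · intro i h1 h2
        by_cases h3 : i < e
        · exact ⟨S, by simp, hcov i (by omega) h3⟩
        · obtain ⟨C, hC, hi⟩ := hl i (by omega) h2
          exact ⟨C, by simp [hC], hi⟩
      · simp only [List.map_cons, List.sum_cons, hS]
        omega

lemma MW.cover (M : MW G d N w) (hd : ∀ e, G.sign e = xor (d e false) (d e true)) :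
    ∃ l : List (SignedCircuit G), (∀ i, ∃ C ∈ l, (w i).1 ∈ C.edges) ∧
      (l.map SignedCircuit.length).sum ≤ 2 * N := by
  classical
  have hpos := M.pos
  have hred : ∀ i r, ∃ j, r ≤ j ∧ j < r + N ∧ w j = w i := by
    have hmul : ∀ k i, w (i + N * k) = w i := by
      intro k
      induction k with
      | zero => simp
      | succ k ih => intro i; rw [mul_add, mul_one, ← add_assoc, M.per, ih]
    intro i r
    have h1 := Nat.div_add_mod (i + N * r - r) N
    have h2 := Nat.mod_lt (i + N * r - r) hpos
    have h3 : r ≤ N * r := Nat.le_mul_of_pos_left r hpos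
    refine ⟨r + (i + N * r - r) % N, by omega, by omega, ?_⟩
    rw [← hmul ((i + N * r - r) / N), ← hmul r i]
    congr 1
    omega
  by_cases hrep : ∃ n, ∃ i, 0 < n ∧ n < N ∧ vx G w i = vx G w (i + n)
  · obtain ⟨a, h0, hN, hv⟩ := Nat.find_spec hrep
    have hmin : ∀ i j, i < j → j - i < Nat.find hrep → vx G w i ≠ vx G w j := by
      intro i j h1 h2 h3
      exact Nat.find_min hrep h2 ⟨i, by omega, by omega,
        by rwa [show i + (j - i) = j by omega]⟩
    generalize Nat.find hrep = n at *
    have L : Lf G w N a (a + n) := ⟨by omega, by omega, hv,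
      fun i j h1 h2 h3 => hmin i j h2 (by omega)⟩
    have LT : Lf G w N (a + N) (a + n + N) := ⟨by omega, by omega,
      by rw [M.vx_per, M.vx_per, hv], fun i j h1 h2 h3 => hmin i j h2 (by omega)⟩
    obtain ⟨l, hl, hs⟩ := M.chainCover hd LT _ a (a + n) L (by omega) rfl
    refine ⟨l, ?_, by omega⟩
    intro i
    obtain ⟨j, h1, h2, h3⟩ := hred i (a + n)
    rw [← h3]
    exact hl j h1 h2
  · push Not at hrep
    have hinj : ∀ i j, 0 ≤ i → i < j → j < N → vx G w i ≠ vx G w j := by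
      intro i j _ h1 h2 h3
      exact hrep (j - i) i (by omega) (by omega) (by rwa [show i + (j - i) = j by omega])
    have hE := M.edge_inj (a := 0) (b := N) (by omega) hinj
    have hA : 0 + (N - 1 + 1) = 0 + N := by omega
    let C := mkC M 0 (N - 1) (by rw [hA, M.vx_per])
      (fun i j h1 h2 => hinj _ _ (by omega) (by omega) (by omega))
      (fun i j h1 h2 => hE _ _ (by omega) (by omega) (by omega))
    have hb : C.Balanced := by
      rw [mkC_balanced M hd, hA, M.per]
    refine ⟨[SignedCircuit.balanced C hb], ?_, ?_⟩
    · intro i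
      obtain ⟨j, h1, h2, h3⟩ := hred i 0
      refine ⟨SignedCircuit.balanced C hb, by simp, ?_⟩
      rw [← h3]
      change (w j).1 ∈ Set.range C.edge
      refine ⟨(⟨j, by omega⟩ : Fin (N - 1 + 1)), ?_⟩
      change (w (0 + j)).1 = _
      rw [zero_add]
    · have : (SignedCircuit.balanced C hb).length = N - 1 + 1 := rfl
      simp only [List.map_cons, List.map_nil, List.sum_cons, List.sum_nil, this]
      omega

lemma flow_cover [Fintype E] (hd : ∀ e, G.sign e = xor (d e false) (d e true)) :
    ∀ (n : ℕ) (f : E → ℕ), Kir G d f → ∑ e, f e = n →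
    ∃ l : List (SignedCircuit G), (∀ e, 0 < f e → ∃ C ∈ l, e ∈ C.edges) ∧
      (l.map SignedCircuit.length).sum ≤ 2 * n := by
  intro n
  induction n using Nat.strong_induction_on with
  | _ n ih =>
    intro f hf hn
    by_cases h0 : ∃ e, 0 < f e
    · obtain ⟨e₀, he₀⟩ := h0
      obtain ⟨l, w, ⟨hl0, ⟨s, hs⟩, hu⟩, M, hlw⟩ := exists_MW hf he₀
      obtain ⟨L, hL, hLs⟩ := M.cover hd
      have hsum : ∑ e, (f e - use l e) + l.length = n := by
        rw [← sum_use l, ← Finset.sum_add_distrib, ← hn]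
        exact Finset.sum_congr rfl fun e _ => Nat.sub_add_cancel (hu e)
      have hpos := M.pos
      have hf' : Kir G d (fun e => f e - use l e) := by
        intro v
        have h1 := sum_use_inc G d v l hs
        have h2 := hf v
        have h3 : ∀ e, (((f e - use l e : ℕ) : ℤ)) = (f e : ℤ) - use l e :=
          fun e => by have := hu e; omega
        simp only [h3, sub_mul, Finset.sum_sub_distrib]
        linarith
      obtain ⟨L', hL', hLs'⟩ := ih (n - l.length) (by omega) _ hf' (by omega)
      refine ⟨L ++ L', ?_, ?_⟩
      · intro e he
        by_cases hue : 0 < use l e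
        · obtain ⟨a, ha, rfl⟩ := use_pos hue
          obtain ⟨k, -, rfl⟩ := hlw a ha
          obtain ⟨C, hC, hC'⟩ := hL k
          exact ⟨C, by simp [hC], hC'⟩
        · obtain ⟨C, hC, hC'⟩ := hL' e (by omega)
          exact ⟨C, by simp [hC], hC'⟩
      · simp only [List.map_append, List.sum_append]
        omega
    · push Not at h0
      refine ⟨[], fun e he => ?_, by simp⟩
      have := h0 e
      omega

end

lemma sum_toFinset_le {α : Type} [DecidableEq α] (g : α → ℕ) (l : List α) :
    ∑ x ∈ l.toFinset, g x ≤ (l.map g).sum := by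
  induction l with
  | nil => simp
  | cons a l ih =>
    rw [List.toFinset_cons, List.map_cons, List.sum_cons]
    by_cases h : a ∈ l.toFinset
    · rw [Finset.insert_eq_of_mem h]; omega
    · rw [Finset.sum_insert h]; omega

lemma kir_of_flow [Fintype E] [DecidableEq V] {G : SignedGraph V E} (O : SOrientation G)
    (φ : E → ℤ) (h : IsFlow O φ) :
    Kir G (O.reorient (fun e => decide (φ e < 0))).dir (fun e => (φ e).natAbs) := by
  intro v
  have hv := h v
  rw [← sub_eq_zero, ← Finset.sum_sub_distrib] at hv
  refine Eq.trans ?_ hv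
  apply Finset.sum_congr rfl
  intro e _
  simp only [Fintype.sum_bool, inc, tau, SOrientation.reorient]
  rcases lt_or_ge (φ e) 0 with h1 | h1
  · have h2 : ((φ e).natAbs : ℤ) = - φ e := by omega
    rw [h2]
    rcases Bool.eq_false_or_eq_true (O.dir e false) with h5 | h5 <;>
      rcases Bool.eq_false_or_eq_true (O.dir e true) with h6 | h6 <;> by_cases h3 : G.ends e false = v <;>
      by_cases h4 : G.ends e true = v <;> simp [h1, h3, h4, h5, h6] <;> try ring
  · have h2 : ((φ e).natAbs : ℤ) = φ e := by omega
    have h1' : ¬ (φ e < 0) := by omega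
    rw [h2]
    rcases Bool.eq_false_or_eq_true (O.dir e false) with h5 | h5 <;>
      rcases Bool.eq_false_or_eq_true (O.dir e true) with h6 | h6 <;> by_cases h3 : G.ends e false = v <;>
      by_cases h4 : G.ends e true = v <;> simp [h1', h3, h4, h5, h6] <;> try ring

end BouchetProof

/-- If Bouchet's conjecture holds (every flow-admissible signed graph has a
nowhere-zero `6`-flow), then every flow-admissible signed graph `G` has a
signed circuit cover of total length at most `10 |E(G)|`. -/
theorem bouchet_implies_short_cover
    (bouchet : ∀ (V E : Type) [Fintype E] [DecidableEq V]
      (G : SignedGraph V E), HasNZFlow G → HasNZkFlow G 6) :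
    ∀ (V E : Type) [Fintype E] [DecidableEq V] (G : SignedGraph V E),
      HasNZFlow G →
      ∃ 𝒞 : Finset (SignedCircuit G),
        (∀ e : E, ∃ C ∈ 𝒞, e ∈ C.edges) ∧
        ∑ C ∈ 𝒞, C.length ≤ 10 * Fintype.card E := by
  intro V E _ _ G hG
  classical
  obtain ⟨O, φ, hflow, hφ⟩ := bouchet V E G hG
  have hk := BouchetProof.kir_of_flow O φ hflow
  obtain ⟨l, hl, hs⟩ := BouchetProof.flow_cover
    (O.reorient (fun e => decide (φ e < 0))).compat _ _ hk rfl
  refine ⟨l.toFinset, ?_, ?_⟩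
  · intro e
    obtain ⟨C, hC, hCe⟩ := hl e (by have := (hφ e).1; omega)
    exact ⟨C, by simpa using hC, hCe⟩
  · refine (BouchetProof.sum_toFinset_le _ l).trans (hs.trans ?_)
    have : ∑ e, (φ e).natAbs ≤ ∑ _e : E, 5 :=
      Finset.sum_le_sum fun e _ => (hφ e).2
    simp only [Finset.sum_const, Finset.card_univ, smul_eq_mul] at this
    omega
end
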